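/- Let X₀(μ), X₁(μ), Y₀(ν), Y₁(ν) be 2-concave complex-valued Banach function spaces and 0 < θ < 1. Then [X₀⊗̂_ε Y₀, X₁⊗̂_ε Y₁]_θ = [X₀,X₁]_θ ⊗̂_ε [Y₀,Y₁]_θ algebraically and topologically. -/

import Mathlib

open Complex MeasureTheory Finset

noncomputable section

namespace Paper

/-- The closed unit strip in the complex plane. -/
def Strip : Set ℂ := {z : ℂ | 0 ≤ z.re ∧ z.re ≤ 1}

/-- The open unit strip in the complex plane. -/
def OStrip : Set ℂ := {z : ℂ | 0 < z.re ∧ z.re < 1}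

/-- `N` is a norm on the complex vector space `V`. -/
def IsNormC {V : Type*} [AddCommGroup V] [Module ℂ V] (N : V → ℝ) : Prop :=
  (∀ x, 0 ≤ N x) ∧ (∀ x, N x = 0 → x = 0) ∧
  (∀ (c : ℂ) (x), N (c • x) = ‖c‖ * N x) ∧ (∀ x y, N (x + y) ≤ N x + N y)

/-- `N` is a lattice norm on `ℝⁿ`. -/
def IsLatticeNorm {n : ℕ} (N : (Fin n → ℝ) → ℝ) : Prop :=
  (∀ x, 0 ≤ N x) ∧ (∀ x, N x = 0 → x = 0) ∧
  (∀ (c : ℝ) (x), N (c • x) = |c| * N x) ∧ (∀ x y, N (x + y) ≤ N x + N y) ∧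
  (∀ x y, (∀ i, |x i| ≤ |y i|) → N x ≤ N y)

/-- The `r`-th power `X^r` of a lattice norm: `‖x‖_{X^r} = ‖ |x|^{1/r} ‖_X^r`. -/
def powNorm {n : ℕ} (r : ℝ) (N : (Fin n → ℝ) → ℝ) (x : Fin n → ℝ) : ℝ :=
  (N fun i => |x i| ^ (1 / r)) ^ r

/-- `N` is `p`-convex with constant `C`. -/
def ConvexWith {n : ℕ} (p C : ℝ) (N : (Fin n → ℝ) → ℝ) : Prop :=
  ∀ (m : ℕ) (x : Fin m → Fin n → ℝ),
    N (fun j => (∑ i, |x i j| ^ p) ^ (1 / p)) ≤ C * (∑ i, N (x i) ^ p) ^ (1 / p)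

/-- `N` is `p`-concave with constant `C`. -/
def ConcaveWith {n : ℕ} (p C : ℝ) (N : (Fin n → ℝ) → ℝ) : Prop :=
  ∀ (m : ℕ) (x : Fin m → Fin n → ℝ),
    (∑ i, N (x i) ^ p) ^ (1 / p) ≤ C * N (fun j => (∑ i, |x i j| ^ p) ^ (1 / p))

/-- The dual lattice norm on `ℝⁿ`. -/
def dualNR {n : ℕ} (N : (Fin n → ℝ) → ℝ) (y : Fin n → ℝ) : ℝ :=
  sSup {r : ℝ | ∃ x, N x ≤ 1 ∧ r = |∑ i, x i * y i|}

/-- The Calderón product norm `X₀^{1-θ}X₁^θ` on `ℝⁿ`. -/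
def calNorm {n : ℕ} (θ : ℝ) (N₀ N₁ : (Fin n → ℝ) → ℝ) (f : Fin n → ℝ) : ℝ :=
  sInf {c : ℝ | ∃ g h : Fin n → ℝ, (∀ i, |f i| = |g i| ^ (1 - θ) * |h i| ^ θ) ∧
    c = N₀ g ^ (1 - θ) * N₁ h ^ θ}

/-- The complex interpolation norm `[N₀,N₁]_θ`, computed via analytic functions
of finite type `z ↦ ∑ φᵢ(z) • vᵢ` on the strip (which, by density, gives the
complex interpolation norm on the intersection for couples with dense intersection). -/
def interpN {D : Type*} [AddCommGroup D] [Module ℂ D]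
    (θ : ℝ) (N₀ N₁ : D → ℝ) (x : D) : ℝ :=
  sInf {c : ℝ | ∃ (m : ℕ) (φ : Fin m → ℂ → ℂ) (v : Fin m → D),
    (∀ i, ContinuousOn (φ i) Strip) ∧
    (∀ i, DifferentiableOn ℂ (φ i) OStrip) ∧
    (∀ i, ∃ B : ℝ, ∀ z ∈ Strip, ‖φ i z‖ ≤ B) ∧
    (∑ i, φ i (θ : ℂ) • v i) = x ∧
    (∀ t : ℝ, N₀ (∑ i, φ i (Complex.I * t) • v i) ≤ c) ∧
    (∀ t : ℝ, N₁ (∑ i, φ i (1 + Complex.I * t) • v i) ≤ c)}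

/-- Operator "norm" of a map with respect to given norm functions. -/
def opN {X Y : Type*} (NX : X → ℝ) (NY : Y → ℝ) (T : X → Y) : ℝ :=
  sSup {r : ℝ | ∃ x, NX x ≤ 1 ∧ r = NY (T x)}

/-- The Hilbert space `ℓ₂`. -/
abbrev Hilb := lp (fun _ : ℕ => ℂ) 2

def hilbNorm (x : Hilb) : ℝ := ‖x‖

/-- `d_θ[M₀,M₁]`: the norm of the identity
`L(ℓ₂,[M₀,M₁]_θ) → [L(ℓ₂,M₀),L(ℓ₂,M₁)]_θ`. -/
def dTheta {V : Type*} [NormedAddCommGroup V] [NormedSpace ℂ V]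
    (θ : ℝ) (N₀ N₁ : V → ℝ) : ℝ :=
  sSup {r : ℝ | ∃ T : Hilb →L[ℂ] V,
    opN hilbNorm (interpN θ N₀ N₁) ⇑T ≤ 1 ∧
    r = interpN θ (fun S : Hilb →L[ℂ] V => opN hilbNorm N₀ ⇑S)
        (fun S : Hilb →L[ℂ] V => opN hilbNorm N₁ ⇑S) T}

/-- Rademacher average `(2^{-m} ∑_ε ‖∑ ±xᵢ‖²)`. -/
def radAvg {V : Type*} [AddCommGroup V] (N : V → ℝ) {m : ℕ} (x : Fin m → V) : ℝ :=
  ((2 : ℝ) ^ m)⁻¹ * ∑ ε : Fin m → Bool, N (∑ i, if ε i then x i else -x i) ^ 2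

/-- `N` has (Rademacher) type 2 with constant `C`. -/
def Type2With {V : Type*} [AddCommGroup V] (N : V → ℝ) (C : ℝ) : Prop :=
  ∀ (m : ℕ) (x : Fin m → V), Real.sqrt (radAvg N x) ≤ C * Real.sqrt (∑ i, N (x i) ^ 2)

/-- `N` has (Rademacher) cotype 2 with constant `C`. -/
def Cotype2With {V : Type*} [AddCommGroup V] (N : V → ℝ) (C : ℝ) : Prop :=
  ∀ (m : ℕ) (x : Fin m → V), Real.sqrt (∑ i, N (x i) ^ 2) ≤ C * Real.sqrt (radAvg N x)

/-- The injective tensor norm of two norm functions. -/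
def injN {V W : Type*} [AddCommGroup V] [Module ℂ V] [AddCommGroup W] [Module ℂ W]
    (NV : V → ℝ) (NW : W → ℝ) (z : TensorProduct ℂ V W) : ℝ :=
  sSup {r : ℝ | ∃ (φ : V →ₗ[ℂ] ℂ) (ψ : W →ₗ[ℂ] ℂ),
    (∀ x, ‖φ x‖ ≤ NV x) ∧ (∀ y, ‖ψ y‖ ≤ NW y) ∧
    r = ‖TensorProduct.lift (((LinearMap.mul ℂ ℂ).comp φ).compl₂ ψ) z‖}

/-- Dual norm on linear functionals. -/
def dualNC {V : Type*} [AddCommGroup V] [Module ℂ V] (N : V → ℝ) (φ : V →ₗ[ℂ] ℂ) : ℝ :=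
  sSup {r : ℝ | ∃ x, N x ≤ 1 ∧ r = ‖φ x‖}

/-- The space of bounded linear functionals (dual space of the completion). -/
def BddDual {V : Type*} [AddCommGroup V] [Module ℂ V] (N : V → ℝ) :
    Submodule ℂ (V →ₗ[ℂ] ℂ) where
  carrier := {φ | ∃ c : ℝ, ∀ x, ‖φ x‖ ≤ c * N x}
  zero_mem' := ⟨0, by simp⟩
  add_mem' := by
    rintro φ ψ ⟨c, hc⟩ ⟨d, hd⟩
    exact ⟨c + d, fun x => by
      have h1 := hc x; have h2 := hd x
      calc ‖(φ + ψ) x‖ = ‖φ x + ψ x‖ := by simp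
        _ ≤ ‖φ x‖ + ‖ψ x‖ := norm_add_le _ _
        _ ≤ (c + d) * N x := by rw [add_mul]; exact add_le_add h1 h2⟩
  smul_mem' := by
    rintro a φ ⟨c, hc⟩
    exact ⟨‖a‖ * c, fun x => by
      have : ‖(a • φ) x‖ = ‖a‖ * ‖φ x‖ := by simp [norm_smul]
      rw [this, mul_assoc]
      exact mul_le_mul_of_nonneg_left (hc x) (norm_nonneg a)⟩

/-- Strictly simple functions with values in `V`: the span of
`v`-valued indicators of finite-measure measurable sets. -/
def SimpleSub {Ω : Type*} [MeasurableSpace Ω] (μ : Measure Ω)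
    (V : Type*) [AddCommGroup V] [Module ℂ V] : Submodule ℂ (Ω → V) :=
  Submodule.span ℂ {f | ∃ (s : Set Ω) (v : V), MeasurableSet s ∧ μ s < ⊤ ∧
    f = s.indicator fun _ => v}

/-- A Banach function space over a measure `μ`, with `K`-valued functions. -/
structure BFS (Ω : Type*) [MeasurableSpace Ω] (μ : Measure Ω) (K : Type*) [RCLike K] where
  mem : (Ω → K) → Prop
  nrm : (Ω → K) → ℝ
  mem_zero : mem 0
  mem_add : ∀ f g, mem f → mem g → mem (f + g)
  mem_smul : ∀ (c : K) (f), mem f → mem (c • f)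
  mem_meas : ∀ f, mem f → AEStronglyMeasurable f μ
  ideal : ∀ f g, AEStronglyMeasurable f μ → mem g →
    (∀ᵐ ω ∂μ, ‖f ω‖ ≤ ‖g ω‖) → mem f ∧ nrm f ≤ nrm g
  nrm_nonneg : ∀ f, 0 ≤ nrm f
  nrm_eq_zero : ∀ f, mem f → nrm f = 0 → f =ᵐ[μ] 0
  nrm_add : ∀ f g, mem f → mem g → nrm (f + g) ≤ nrm f + nrm g
  nrm_smul : ∀ (c : K) (f), nrm (c • f) = ‖c‖ * nrm f
  mem_indicator : ∀ s : Set Ω, MeasurableSet s → μ s < ⊤ →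
    mem (s.indicator fun _ => 1)
  complete : ∀ f : ℕ → Ω → K, (∀ k, mem (f k)) →
    (∀ ε : ℝ, 0 < ε → ∃ N : ℕ, ∀ p q, N ≤ p → N ≤ q → nrm (f p - f q) < ε) →
    ∃ g, mem g ∧ ∀ ε : ℝ, 0 < ε → ∃ N : ℕ, ∀ p, N ≤ p → nrm (f p - g) < ε

variable {Ω : Type*} [MeasurableSpace Ω] {μ : Measure Ω} {K : Type*} [RCLike K]

/-- `X` is `r`-convex with constant `C`. -/
def BFS.RConvexWith (X : BFS Ω μ K) (r C : ℝ) : Prop :=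
  ∀ (m : ℕ) (f : Fin m → Ω → K), (∀ i, X.mem (f i)) →
    X.mem (fun ω => ((((∑ i, ‖f i ω‖ ^ r) ^ (1 / r) : ℝ) : K))) ∧
    X.nrm (fun ω => ((((∑ i, ‖f i ω‖ ^ r) ^ (1 / r) : ℝ) : K))) ≤
      C * (∑ i, X.nrm (f i) ^ r) ^ (1 / r)

/-- `X` is `r`-concave with constant `C`. -/
def BFS.RConcaveWith (X : BFS Ω μ K) (r C : ℝ) : Prop :=
  ∀ (m : ℕ) (f : Fin m → Ω → K), (∀ i, X.mem (f i)) →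
    (∑ i, X.nrm (f i) ^ r) ^ (1 / r) ≤
      C * X.nrm (fun ω => ((((∑ i, ‖f i ω‖ ^ r) ^ (1 / r) : ℝ) : K)))

/-- The Mazur–Orlicz theorem: a sublinear functional `p` dominating the prescribed values `q i` at
`s i` on all nonnegative combinations dominates a linear functional that is at least `q i` at
`s i`. -/
theorem mazur_orlicz {V ι : Type*} [AddCommGroup V] [Module ℝ V] (p : V → ℝ)
    (hp_smul : ∀ c : ℝ, 0 < c → ∀ x, p (c • x) = c * p x)
    (hp_add : ∀ x y, p (x + y) ≤ p x + p y) (s : ι → V) (q : ι → ℝ)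
    (h : ∀ c : ι →₀ ℝ, (∀ i, 0 ≤ c i) →
      ∑ i ∈ c.support, c i * q i ≤ p (∑ i ∈ c.support, c i • s i)) :
    ∃ L : V →ₗ[ℝ] ℝ, (∀ x, L x ≤ p x) ∧ ∀ i, q i ≤ L (s i) := by
  have p0 : p 0 = 0 := by have := hp_smul 2 (by norm_num) 0; rw [smul_zero] at this; linarith
  let T := Finsupp.linearCombination ℝ s
  let Q := Finsupp.linearCombination ℝ q
  have hT : ∀ c : ι →₀ ℝ, (∀ i, 0 ≤ c i) → Q c ≤ p (T c) := by
    intro c hc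
    simpa [T, Q, Finsupp.linearCombination_apply, Finsupp.sum] using h c hc
  let C : Type _ := {c : ι →₀ ℝ // ∀ i, 0 ≤ c i}
  have : Nonempty C := ⟨⟨0, by simp⟩⟩
  let P : V → ℝ := fun x => ⨅ c : C, (p (x + T c.1) - Q c.1)
  have hbdd : ∀ x, BddBelow (Set.range fun c : C => p (x + T c.1) - Q c.1) := by
    intro x
    refine ⟨- p (-x), ?_⟩
    rintro _ ⟨c, rfl⟩
    have h1 := hT c.1 c.2
    have h2 := hp_add (x + T c.1) (-x)
    rw [add_neg_cancel_comm] at h2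
    simp only
    linarith
  have hle : ∀ x (c : C), P x ≤ p (x + T c.1) - Q c.1 := fun x c => ciInf_le (hbdd x) c
  have hsm : ∀ c : ℝ, 0 < c → ∀ x, P (c • x) ≤ c * P x := by
    intro c hc x
    rw [← div_le_iff₀' hc]
    refine le_ciInf fun d => ?_
    rw [div_le_iff₀' hc]
    refine (hle _ ⟨c • d.1, fun i => mul_nonneg hc.le (d.2 i)⟩).trans ?_
    simp only [map_smul, ← smul_add, hp_smul c hc, smul_eq_mul]
    linarith
  obtain ⟨L, -, hL⟩ := exists_extension_of_le_sublinear (E := V)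
    ⟨⊥, 0⟩ P (fun c hc x => le_antisymm (hsm c hc x) (by
      have := hsm c⁻¹ (inv_pos.2 hc) (c • x)
      rw [inv_smul_smul₀ hc.ne'] at this
      calc c * P x ≤ c * (c⁻¹ * P (c • x)) := by gcongr
        _ = P (c • x) := by field_simp))
    (fun x y => by
      refine le_ciInf_add_ciInf fun c d => ?_
      refine (hle _ ⟨c.1 + d.1, fun i => add_nonneg (c.2 i) (d.2 i)⟩).trans ?_
      simp only [map_add]
      have := hp_add (x + T c.1) (y + T d.1)
      rw [show x + y + (T c.1 + T d.1) = x + T c.1 + (y + T d.1) by abel]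
      linarith)
    (by
      rintro ⟨x, hx⟩
      have hx : x = 0 := hx
      subst hx
      refine le_ciInf fun c => ?_
      have h1 := hT c.1 c.2
      simpa using h1)
  refine ⟨L, fun x => (hL x).trans ?_, fun i => ?_⟩
  · simpa using hle x ⟨0, by simp⟩
  · have h1 := (hL (-s i)).trans (hle _ ⟨Finsupp.single i 1, fun j => by
      classical
      rw [Finsupp.single_apply]; split_ifs <;> norm_num⟩)
    simp [T, Q, p0] at h1
    linarith

/-- A real-linear functional dominated by a complex seminorm is the real part of a complex-linear
functional dominated by the same seminorm. -/
theorem exists_complex_functional_of_real {F : Type*} [AddCommGroup F] [Module ℂ F]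
    (S : Seminorm ℂ F) (l : F →ₗ[ℝ] ℝ) (hl : ∀ x, l x ≤ S x) :
    ∃ Φ : F →ₗ[ℂ] ℂ, (∀ x, ‖Φ x‖ ≤ S x) ∧ ∀ x, (Φ x).re = l x := by
  have hre : ∀ x, (Module.Dual.extendRCLike (𝕜 := ℂ) l x).re = l x := fun x => by
    simp [Module.Dual.extendRCLike_apply]
  refine ⟨Module.Dual.extendRCLike (𝕜 := ℂ) l, fun x => ?_, hre⟩
  set Φ := Module.Dual.extendRCLike (𝕜 := ℂ) l
  by_cases h0 : Φ x = 0
  · rw [h0, norm_zero]; exact apply_nonneg S x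
  have hn : ‖Φ x‖ ≠ 0 := norm_ne_zero_iff.2 h0
  set u : ℂ := (starRingEnd ℂ) (Φ x) / ‖Φ x‖ with hu
  have hu1 : ‖u‖ = 1 := by simp [hu, hn]
  have h1 : Φ (u • x) = (‖Φ x‖ : ℂ) := by
    rw [map_smul, smul_eq_mul, hu, div_mul_eq_mul_div, Complex.conj_mul', sq]
    field_simp
  calc ‖Φ x‖ = (Φ (u • x)).re := by rw [h1, Complex.ofReal_re]
    _ = l (u • x) := hre _
    _ ≤ S (u • x) := hl _
    _ = S x := by rw [map_smul_eq_mul, hu1, one_mul]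

/-- A linear functional on `E` dominated by `N ∘ J + R` decomposes as `Φ ∘ J` plus a remainder
dominated by `R`, with `Φ` dominated by `N`. -/
theorem exists_dominated_extension {D E : Type*} [AddCommGroup D] [Module ℂ D] [AddCommGroup E]
    [Module ℂ E] (N : Seminorm ℂ D) (R : Seminorm ℂ E) (J : E →ₗ[ℂ] D) (Λ : E →ₗ[ℂ] ℂ)
    (h : ∀ x, ‖Λ x‖ ≤ N (J x) + R x) :
    ∃ Φ : D →ₗ[ℂ] ℂ, (∀ x, ‖Φ x‖ ≤ N x) ∧ ∀ x, ‖Λ x - Φ (J x)‖ ≤ R x := by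
  let _ : Module ℝ D := Module.complexToReal D
  let _ : Module ℝ E := Module.complexToReal E
  obtain ⟨L, hL, hs⟩ := mazur_orlicz (V := D × E) (ι := E) (fun v => N v.1 + R v.2)
    (fun c hc x => by
      have h1 := map_smul_eq_mul N (c : ℂ) x.1
      have h2 := map_smul_eq_mul R (c : ℂ) x.2
      simp only [Complex.norm_real, Real.norm_of_nonneg hc.le, Complex.coe_smul] at h1 h2
      simp only [Prod.smul_fst, Prod.smul_snd, h1, h2]; ring)
    (fun x y => by
      have h1 := map_add_le_add N x.1 y.1
      have h2 := map_add_le_add R x.2 y.2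
      simp only [Prod.fst_add, Prod.snd_add]; linarith)
    (fun x => (J x, x)) (fun x => (Λ x).re)
    (fun c _ => by
      have e : ∑ i ∈ c.support, c i • (J i, i) = (J (∑ i ∈ c.support, c i • i),
          ∑ i ∈ c.support, c i • i) := by
        rw [map_sum]
        ext <;> simp [Prod.fst_sum, Prod.snd_sum]
      rw [e]
      refine le_trans (le_of_eq ?_) ((Complex.re_le_norm _).trans (h _))
      simp [map_sum])
  have heq : ∀ x, (Λ x).re = L (J x, x) := by
    intro x
    refine le_antisymm (hs x) ?_
    have := hs (-x)
    rw [show (J (-x), -x) = -(J x, x) by simp, map_neg L] at this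
    simp at this
    linarith
  obtain ⟨Φ, hΦ, hΦre⟩ := exists_complex_functional_of_real N
    (L.comp (LinearMap.inl ℝ D E)) (fun x => by simpa using hL (x, 0))
  obtain ⟨Ψ, hΨ, hΨre⟩ := exists_complex_functional_of_real R
    (L.comp (LinearMap.inr ℝ D E)) (fun x => by simpa using hL (0, x))
  have hadd : ∀ x, Λ x = Φ (J x) + Ψ x := by
    have hre : ∀ x, (Λ x).re = (Φ (J x) + Ψ x).re := by
      intro x
      rw [heq, Complex.add_re, hΦre, hΨre]
      simp [← map_add]
    intro x
    refine Complex.ext (hre x) ?_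
    have := hre (Complex.I • x)
    simp only [map_smul, smul_eq_mul, ← mul_add, Complex.I_mul_re, neg_inj] at this
    exact this
  exact ⟨Φ, hΦ, fun x => by rw [hadd, add_sub_cancel_left]; exact hΨ x⟩

/-- The Rademacher sum with coefficients `x`. -/
def radSum {N : ℕ} (x : Fin N → ℂ) (ω : Fin N → Bool) : ℂ := ∑ k, if ω k then x k else -x k

theorem sum_radSum_succ {M : Type*} [AddCommMonoid M] {N : ℕ} (f : ℂ → ℂ → M)
    (x y : Fin (N + 1) → ℂ) :
    ∑ ω, f (radSum x ω) (radSum y ω) =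
      ∑ ω, (f (x 0 + radSum (fun k => x k.succ) ω) (y 0 + radSum (fun k => y k.succ) ω) +
        f (-x 0 + radSum (fun k => x k.succ) ω) (-y 0 + radSum (fun k => y k.succ) ω)) := by
  rw [← (Fin.consEquiv (fun _ : Fin (N + 1) => Bool)).sum_comp, Fintype.sum_prod_type,
    Fintype.sum_bool, ← Finset.sum_add_distrib]
  simp [radSum, Fin.sum_univ_succ, Fin.consEquiv]

theorem sum_radSum_mul {N : ℕ} (x y : Fin N → ℂ) :
    ∑ ω, radSum x ω * radSum y ω = 2 ^ N * ∑ k, x k * y k := by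
  induction N with
  | zero => simp [radSum]
  | succ N ih =>
    rw [sum_radSum_succ (fun a b => a * b), Fin.sum_univ_succ, mul_add, pow_succ]
    have : ∀ ω : Fin N → Bool,
        (x 0 + radSum (fun k => x k.succ) ω) * (y 0 + radSum (fun k => y k.succ) ω) +
        (-x 0 + radSum (fun k => x k.succ) ω) * (-y 0 + radSum (fun k => y k.succ) ω) =
        2 * (x 0 * y 0) + 2 * (radSum (fun k => x k.succ) ω * radSum (fun k => y k.succ) ω) :=
      fun ω => by ring
    simp_rw [this]
    rw [Finset.sum_add_distrib, Finset.sum_const, ← Finset.mul_sum, ih]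
    simp; ring

theorem norm_add_sq_add_norm_neg_add_sq (a b : ℂ) :
    ‖a + b‖ ^ 2 + ‖-a + b‖ ^ 2 = 2 * (‖a‖ ^ 2 + ‖b‖ ^ 2) := by
  simp only [← Complex.normSq_eq_norm_sq, Complex.normSq_apply, Complex.add_re, Complex.add_im,
    Complex.neg_re, Complex.neg_im]
  ring

theorem norm_add_pow_four_add_le (a b : ℂ) :
    ‖a + b‖ ^ 4 + ‖-a + b‖ ^ 4 ≤ 2 * ‖b‖ ^ 4 + 12 * ‖a‖ ^ 2 * ‖b‖ ^ 2 + 2 * ‖a‖ ^ 4 := by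
  have h1 := norm_add_sq_add_norm_neg_add_sq a b
  have h2 : (‖a + b‖ ^ 2 - ‖-a + b‖ ^ 2) ^ 2 ≤ 16 * (‖a‖ ^ 2 * ‖b‖ ^ 2) := by
    simp only [← Complex.normSq_eq_norm_sq, Complex.normSq_apply, Complex.add_re, Complex.add_im,
      Complex.neg_re, Complex.neg_im]
    nlinarith [sq_nonneg (a.re * b.im - a.im * b.re)]
  nlinarith [congrArg (· ^ 2) h1]

theorem sum_norm_radSum_sq {N : ℕ} (x : Fin N → ℂ) :
    ∑ ω, ‖radSum x ω‖ ^ 2 = 2 ^ N * ∑ k, ‖x k‖ ^ 2 := by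
  induction N with
  | zero => simp [radSum]
  | succ N ih =>
    rw [sum_radSum_succ (fun a _ => ‖a‖ ^ 2) x x, Fin.sum_univ_succ, mul_add, pow_succ]
    simp_rw [norm_add_sq_add_norm_neg_add_sq]
    rw [← Finset.mul_sum, Finset.sum_add_distrib, ih]
    simp; ring

theorem sum_norm_radSum_pow_four_le {N : ℕ} (x : Fin N → ℂ) :
    ∑ ω, ‖radSum x ω‖ ^ 4 ≤ 2 ^ N * (3 * (∑ k, ‖x k‖ ^ 2) ^ 2) := by
  induction N with
  | zero => simp [radSum]
  | succ N ih =>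
    rw [sum_radSum_succ (fun a _ => ‖a‖ ^ 4) x x, Fin.sum_univ_succ]
    refine (Finset.sum_le_sum fun ω _ => norm_add_pow_four_add_le _ _).trans ?_
    rw [Finset.sum_add_distrib, Finset.sum_add_distrib, ← Finset.mul_sum, ← Finset.mul_sum,
      sum_norm_radSum_sq]
    have h := ih fun k => x k.succ
    set s := ∑ k : Fin N, ‖x k.succ‖ ^ 2
    simp only [Finset.sum_const, Finset.card_univ, Fintype.card_fun, Fintype.card_bool,
      Fintype.card_fin, nsmul_eq_mul, Nat.cast_pow, Nat.cast_ofNat]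
    rw [pow_succ (2 : ℝ) N]
    have h2 : (0 : ℝ) ≤ 2 ^ N * ‖x 0‖ ^ 4 := by positivity
    nlinarith

section Grothendieck

variable {ι κ : Type*} [Fintype ι] [Fintype κ]

/-- The bilinear form of the matrix `a` on vector-valued functions. -/
def vecForm (a : ι → κ → ℂ) {K : Type*} [Fintype K] (x : ι → K → ℂ) (y : κ → K → ℂ) : ℂ :=
  ∑ i, ∑ j, a i j * ∑ k, x i k * y j k

theorem vecForm_comp_equiv (a : ι → κ → ℂ) {K K' : Type*} [Fintype K] [Fintype K'] (e : K' ≃ K)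
    (x : ι → K → ℂ) (y : κ → K → ℂ) :
    vecForm a (fun i k => x i (e k)) (fun j k => y j (e k)) = vecForm a x y := by
  exact Finset.sum_congr rfl fun i _ => Finset.sum_congr rfl fun j _ =>
    congrArg (a i j * ·) (e.sum_comp fun k => x i k * y j k)

theorem vecForm_add_left (a : ι → κ → ℂ) {K : Type*} [Fintype K] (x x' : ι → K → ℂ)
    (y : κ → K → ℂ) : vecForm a (x + x') y = vecForm a x y + vecForm a x' y := by
  simp only [vecForm, ← Finset.sum_add_distrib, ← mul_add, Pi.add_apply, add_mul]

theorem vecForm_add_right (a : ι → κ → ℂ) {K : Type*} [Fintype K] (x : ι → K → ℂ)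
    (y y' : κ → K → ℂ) : vecForm a x (y + y') = vecForm a x y + vecForm a x y' := by
  simp only [vecForm, ← Finset.sum_add_distrib, ← mul_add, Pi.add_apply]

theorem vecForm_smul_left (a : ι → κ → ℂ) {K : Type*} [Fintype K] (c : ℂ) (x : ι → K → ℂ)
    (y : κ → K → ℂ) : vecForm a (c • x) y = c * vecForm a x y := by
  simp only [vecForm, Finset.mul_sum, Pi.smul_apply, smul_eq_mul]
  refine Finset.sum_congr rfl fun i _ => Finset.sum_congr rfl fun j _ =>
    Finset.sum_congr rfl fun k _ => by ring

theorem vecForm_smul_right (a : ι → κ → ℂ) {K : Type*} [Fintype K] (c : ℂ) (x : ι → K → ℂ)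
    (y : κ → K → ℂ) : vecForm a x (c • y) = c * vecForm a x y := by
  simp only [vecForm, Finset.mul_sum, Pi.smul_apply, smul_eq_mul]
  refine Finset.sum_congr rfl fun i _ => Finset.sum_congr rfl fun j _ =>
    Finset.sum_congr rfl fun k _ => by ring

theorem norm_sum_mul_le_one {K : Type*} [Fintype K] (x y : K → ℂ) (hx : ∑ k, ‖x k‖ ^ 2 ≤ 1)
    (hy : ∑ k, ‖y k‖ ^ 2 ≤ 1) : ‖∑ k, x k * y k‖ ≤ 1 := by
  have h : ∑ k, ‖x k‖ * ‖y k‖ ≤ ∑ k, (‖x k‖ ^ 2 + ‖y k‖ ^ 2) / 2 :=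
    Finset.sum_le_sum fun k _ => by nlinarith [sq_nonneg (‖x k‖ - ‖y k‖)]
  rw [← Finset.sum_div, Finset.sum_add_distrib] at h
  refine (norm_sum_le _ _).trans ?_
  simp_rw [norm_mul]
  linarith

/-- The values of the form `a` on finite-dimensional unit vectors, in absolute value. -/
def vecFormValues (a : ι → κ → ℂ) : Set ℝ :=
  {r | ∃ (N : ℕ) (x : ι → Fin N → ℂ) (y : κ → Fin N → ℂ),
    (∀ i, ∑ k, ‖x i k‖ ^ 2 ≤ 1) ∧ (∀ j, ∑ k, ‖y j k‖ ^ 2 ≤ 1) ∧ r = ‖vecForm a x y‖}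

theorem norm_vecForm_le_sSup (a : ι → κ → ℂ) {K : Type*} [Fintype K] (x : ι → K → ℂ)
    (y : κ → K → ℂ) (hx : ∀ i, ∑ k, ‖x i k‖ ^ 2 ≤ 1) (hy : ∀ j, ∑ k, ‖y j k‖ ^ 2 ≤ 1) :
    ‖vecForm a x y‖ ≤ sSup (vecFormValues a) := by
  have hA : BddAbove (vecFormValues a) := by
    refine ⟨∑ i, ∑ j, ‖a i j‖, ?_⟩
    rintro r ⟨N, x, y, hx, hy, rfl⟩
    refine (norm_sum_le _ _).trans (Finset.sum_le_sum fun i _ =>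
      (norm_sum_le _ _).trans (Finset.sum_le_sum fun j _ => ?_))
    rw [norm_mul]
    exact mul_le_of_le_one_right (norm_nonneg _) (norm_sum_mul_le_one _ _ (hx i) (hy j))
  let e := (Fintype.equivFin K).symm
  refine le_csSup hA ⟨_, fun i k => x i (e k), fun j k => y j (e k), fun i => ?_, fun j => ?_, ?_⟩
  · rw [e.sum_comp fun k => ‖x i k‖ ^ 2]; exact hx i
  · rw [e.sum_comp fun k => ‖y j k‖ ^ 2]; exact hy j
  · rw [vecForm_comp_equiv]

/-- The part of `z` of modulus at most `6`. -/
def cutLow (z : ℂ) : ℂ := if ‖z‖ ≤ 6 then z else 0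

theorem norm_cutLow_le (z : ℂ) : ‖cutLow z‖ ≤ ‖z‖ := by
  unfold cutLow; split_ifs <;> simp

theorem norm_cutLow_le_six (z : ℂ) : ‖cutLow z‖ ≤ 6 := by
  unfold cutLow; split_ifs with h
  · exact h
  · simp

theorem norm_sub_cutLow_sq_le (z : ℂ) : ‖z - cutLow z‖ ^ 2 ≤ ‖z‖ ^ 4 / 36 := by
  unfold cutLow; split_ifs with h
  · rw [sub_self, norm_zero, zero_pow two_ne_zero]; positivity
  · rw [sub_zero]
    have : 36 ≤ ‖z‖ ^ 2 := by nlinarith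
    nlinarith [sq_nonneg ‖z‖]

/-- **Grothendieck's inequality** for complex matrices, with constant `108`. -/
theorem grothendieck_inequality (a : ι → κ → ℂ) (B : ℝ)
    (ha : ∀ (s : ι → ℂ) (t : κ → ℂ), (∀ i, ‖s i‖ ≤ 1) → (∀ j, ‖t j‖ ≤ 1) →
      ‖∑ i, ∑ j, a i j * (s i * t j)‖ ≤ B)
    {K : Type*} [Fintype K] (x : ι → K → ℂ) (y : κ → K → ℂ)
    (hx : ∀ i, ∑ k, ‖x i k‖ ^ 2 ≤ 1) (hy : ∀ j, ∑ k, ‖y j k‖ ^ 2 ≤ 1) :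
    ‖vecForm a x y‖ ≤ 108 * B := by
  refine (norm_vecForm_le_sSup a x y hx hy).trans ?_
  suffices h : sSup (vecFormValues a) ≤ 36 * B + 2 / 3 * sSup (vecFormValues a) by linarith
  refine csSup_le ⟨_, 0, 0, 0, by simp, by simp, rfl⟩ ?_
  rintro r ⟨N, x, y, hx, hy, rfl⟩
  set S := sSup (vecFormValues a)
  set c : ℝ := (√(2 ^ N))⁻¹ with hc
  have hc2 : c ^ 2 * 2 ^ N = 1 := by
    rw [hc, inv_pow, Real.sq_sqrt (by positivity)]
    exact inv_mul_cancel₀ (by positivity)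
  have hc0 : 0 ≤ c := by positivity
  have hsum : ∀ u : Fin N → ℂ, ∑ k, ‖u k‖ ^ 2 ≤ 1 →
      ∑ ω, ‖(c : ℂ) * radSum u ω‖ ^ 2 ≤ 1 := by
    intro u hu
    simp_rw [norm_mul, mul_pow, ← Finset.mul_sum, Complex.norm_real, Real.norm_of_nonneg hc0]
    rw [sum_norm_radSum_sq, ← mul_assoc, hc2, one_mul]; exact hu
  have hlow : ∀ u : Fin N → ℂ, ∑ k, ‖u k‖ ^ 2 ≤ 1 →
      ∑ ω, ‖(c : ℂ) * cutLow (radSum u ω)‖ ^ 2 ≤ 1 := by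
    intro u hu
    refine (Finset.sum_le_sum fun ω _ => ?_).trans (hsum u hu)
    rw [norm_mul, norm_mul]
    gcongr
    exact norm_cutLow_le _
  have hhigh : ∀ u : Fin N → ℂ, ∑ k, ‖u k‖ ^ 2 ≤ 1 →
      ∑ ω, ‖(3 : ℂ) * ((c : ℂ) * (radSum u ω - cutLow (radSum u ω)))‖ ^ 2 ≤ 1 := by
    intro u hu
    have h1 := sum_norm_radSum_pow_four_le u
    have h2 : (∑ k, ‖u k‖ ^ 2) ^ 2 ≤ 1 := pow_le_one₀ (by positivity) hu
    calc ∑ ω, ‖(3 : ℂ) * ((c : ℂ) * (radSum u ω - cutLow (radSum u ω)))‖ ^ 2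
        = 9 * (c ^ 2 * ∑ ω, ‖radSum u ω - cutLow (radSum u ω)‖ ^ 2) := by
          simp_rw [norm_mul, mul_pow, ← Finset.mul_sum, Complex.norm_real, Real.norm_of_nonneg hc0]
          norm_num
      _ ≤ 9 * (c ^ 2 * ∑ ω, ‖radSum u ω‖ ^ 4 / 36) := by
          gcongr; exact norm_sub_cutLow_sq_le _
      _ = (c ^ 2 * ∑ ω, ‖radSum u ω‖ ^ 4) / 4 := by rw [← Finset.sum_div]; ring
      _ ≤ (c ^ 2 * (2 ^ N * (3 * 1))) / 4 := by
          have : ∑ ω, ‖radSum u ω‖ ^ 4 ≤ 2 ^ N * (3 * 1) := h1.trans (by gcongr)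
          gcongr
      _ = (c ^ 2 * 2 ^ N) * 3 / 4 := by ring
      _ ≤ 1 := by rw [hc2]; norm_num
  let R₁ : ι → (Fin N → Bool) → ℂ := fun i ω => c * radSum (x i) ω
  let L₁ : ι → (Fin N → Bool) → ℂ := fun i ω => c * cutLow (radSum (x i) ω)
  let H₁ : ι → (Fin N → Bool) → ℂ := fun i ω => c * (radSum (x i) ω - cutLow (radSum (x i) ω))
  let R₂ : κ → (Fin N → Bool) → ℂ := fun i ω => c * radSum (y i) ω
  let L₂ : κ → (Fin N → Bool) → ℂ := fun i ω => c * cutLow (radSum (y i) ω)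
  let H₂ : κ → (Fin N → Bool) → ℂ := fun i ω => c * (radSum (y i) ω - cutLow (radSum (y i) ω))
  have e1 : R₁ = L₁ + H₁ := by ext i ω; simp only [R₁, L₁, H₁, Pi.add_apply]; ring
  have e2 : R₂ = L₂ + H₂ := by ext i ω; simp only [R₂, L₂, H₂, Pi.add_apply]; ring
  have e0 : vecForm a x y = vecForm a R₁ R₂ := by
    refine Finset.sum_congr rfl fun i _ => Finset.sum_congr rfl fun j _ => ?_
    congr 1
    have : ∑ ω, R₁ i ω * R₂ j ω = (c : ℂ) ^ 2 * ∑ ω, radSum (x i) ω * radSum (y j) ω := by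
      rw [Finset.mul_sum]; exact Finset.sum_congr rfl fun ω _ => by simp only [R₁, R₂]; ring
    rw [this, sum_radSum_mul, ← mul_assoc]
    have : (c : ℂ) ^ 2 * 2 ^ N = 1 := by exact_mod_cast hc2
    rw [this, one_mul]
  have e3 : vecForm a x y = vecForm a L₁ L₂ + vecForm a H₁ L₂ + vecForm a R₁ H₂ := by
    rw [e0, ← vecForm_add_left, ← e1, e2, vecForm_add_right]
  have b1 : ‖vecForm a L₁ L₂‖ ≤ 36 * B := by
    have : vecForm a L₁ L₂ = ∑ ω : Fin N → Bool, ((36 * c ^ 2 : ℝ) : ℂ) * ∑ i, ∑ j, a i j *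
        (cutLow (radSum (x i) ω) / 6 * (cutLow (radSum (y j) ω) / 6)) := by
      simp only [vecForm, Finset.mul_sum]
      conv_rhs => rw [Finset.sum_comm]
      refine Finset.sum_congr rfl fun i _ => ?_
      rw [Finset.sum_comm]
      refine Finset.sum_congr rfl fun ω _ => Finset.sum_congr rfl fun j _ => ?_
      simp only [L₁, L₂]; push_cast; ring
    rw [this]
    have hb : ∀ z : ℂ, ‖cutLow z / 6‖ ≤ 1 := fun z => by
      have := norm_cutLow_le_six z
      rw [norm_div]; norm_num; linarith
    calc _ ≤ ∑ ω : Fin N → Bool, (36 * c ^ 2) * B := by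
          refine (norm_sum_le _ _).trans (Finset.sum_le_sum fun ω _ => ?_)
          rw [norm_mul, Complex.norm_real, Real.norm_of_nonneg (by positivity)]
          gcongr
          exact ha _ _ (fun i => hb _) (fun j => hb _)
      _ = 36 * B * (c ^ 2 * 2 ^ N) := by simp; ring
      _ = 36 * B := by rw [hc2, mul_one]
  have b2 : ‖vecForm a H₁ L₂‖ ≤ S / 3 := by
    have := norm_vecForm_le_sSup a ((3 : ℂ) • H₁) L₂ (fun i => hhigh _ (hx i))
      (fun j => hlow _ (hy j))
    rw [vecForm_smul_left, norm_mul] at this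
    norm_num at this
    change _ ≤ S at this
    linarith
  have b3 : ‖vecForm a R₁ H₂‖ ≤ S / 3 := by
    have := norm_vecForm_le_sSup a R₁ ((3 : ℂ) • H₂) (fun i => hsum _ (hx i))
      (fun j => hhigh _ (hy j))
    rw [vecForm_smul_right, norm_mul] at this
    norm_num at this
    change _ ≤ S at this
    linarith
  rw [e3]
  have := norm_add₃_le (a := vecForm a L₁ L₂) (b := vecForm a H₁ L₂) (c := vecForm a R₁ H₂)
  linarith

end Grothendieck

section Scalar

variable {θ : ℝ}

theorem sum_mul_rpow_mul_rpow_le {α : Type*} (s : Finset α) (hθ : 0 < θ) (hθ1 : θ < 1)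
    (c g h : α → ℝ) (hc : ∀ i, 0 ≤ c i) (hg : ∀ i, 0 ≤ g i) (hh : ∀ i, 0 ≤ h i) :
    ∑ i ∈ s, c i * (g i ^ (1 - θ) * h i ^ θ) ≤
      (∑ i ∈ s, c i * g i) ^ (1 - θ) * (∑ i ∈ s, c i * h i) ^ θ := by
  have h1θ : 0 < 1 - θ := by linarith
  have hpq : Real.HolderConjugate (1 / (1 - θ)) (1 / θ) := by
    constructor
    · simp
    · positivity
    · positivity
  have := Real.inner_le_Lp_mul_Lq_of_nonneg s (f := fun i => (c i * g i) ^ (1 - θ))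
    (g := fun i => (c i * h i) ^ θ) hpq (fun i _ => Real.rpow_nonneg (mul_nonneg (hc i) (hg i)) _)
    (fun i _ => Real.rpow_nonneg (mul_nonneg (hc i) (hh i)) _)
  have e1 : ∀ i, ((c i * g i) ^ (1 - θ)) ^ (1 / (1 - θ)) = c i * g i := fun i => by
    rw [← Real.rpow_mul (mul_nonneg (hc i) (hg i)), mul_one_div_cancel h1θ.ne', Real.rpow_one]
  have e2 : ∀ i, ((c i * h i) ^ θ) ^ (1 / θ) = c i * h i := fun i => by
    rw [← Real.rpow_mul (mul_nonneg (hc i) (hh i)), mul_one_div_cancel hθ.ne', Real.rpow_one]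
  simp_rw [e1, e2, one_div_one_div] at this
  refine le_trans (le_of_eq (Finset.sum_congr rfl fun i _ => ?_)) this
  rw [Real.mul_rpow (hc i) (hg i), Real.mul_rpow (hc i) (hh i)]
  have : c i = c i ^ (1 - θ) * c i ^ θ := by
    rw [← Real.rpow_add' (hc i) (by norm_num)]; simp
  nth_rewrite 1 [this]; ring

theorem exists_ratio (hθ : 0 < θ) (hθ1 : θ < 1) {a b x : ℝ} (ha : 0 ≤ a) (hb : 0 ≤ b)
    (hx : x ≤ a ^ (1 - θ) * b ^ θ) :
    ∃ r : ℝ, 0 < r ∧ x * r ^ (-θ) ≤ a ∧ x * r ^ (1 - θ) ≤ b := by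
  have h1θ : 0 < 1 - θ := by linarith
  rcases ha.eq_or_lt with rfl | ha'
  · rw [Real.zero_rpow h1θ.ne', zero_mul] at hx
    exact ⟨1, one_pos, by simpa using hx, by simpa using hx.trans hb⟩
  rcases hb.eq_or_lt with rfl | hb'
  · rw [Real.zero_rpow hθ.ne', mul_zero] at hx
    exact ⟨1, one_pos, by simpa using hx.trans ha, by simpa using hx⟩
  refine ⟨b / a, by positivity, ?_, ?_⟩
  · refine (mul_le_mul_of_nonneg_right hx (by positivity)).trans (le_of_eq ?_)
    rw [Real.div_rpow hb ha, Real.rpow_neg hb, Real.rpow_neg ha, Real.rpow_sub ha', Real.rpow_one]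
    field_simp
  · refine (mul_le_mul_of_nonneg_right hx (by positivity)).trans (le_of_eq ?_)
    rw [Real.div_rpow hb ha, Real.rpow_sub hb', Real.rpow_one]
    field_simp

theorem le_rpow_mul_rpow_of_forall (hθ : 0 < θ) (hθ1 : θ < 1) {a b x : ℝ} (ha : 0 ≤ a)
    (hb : 0 ≤ b)
    (h : ∀ s t : ℝ, 0 < s → 0 < t → x * (s ^ (1 - θ) * t ^ θ) ≤ (1 - θ) * (a * s) + θ * (b * t)) :
    x ≤ a ^ (1 - θ) * b ^ θ := by
  have h1θ : 0 < 1 - θ := by linarith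
  have key : ∀ ε : ℝ, 0 < ε → x ≤ (a + ε) ^ (1 - θ) * (b + ε) ^ θ := by
    intro ε hε
    have ha' : 0 < a + ε := by linarith
    have hb' : 0 < b + ε := by linarith
    have h1 := h (a + ε)⁻¹ (b + ε)⁻¹ (by positivity) (by positivity)
    have h2 : a * (a + ε)⁻¹ ≤ 1 := by rw [← div_eq_mul_inv, div_le_one ha']; linarith
    have h3 : b * (b + ε)⁻¹ ≤ 1 := by rw [← div_eq_mul_inv, div_le_one hb']; linarith
    rw [Real.inv_rpow ha'.le, Real.inv_rpow hb'.le, ← mul_inv, ← div_eq_mul_inv] at h1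
    have h4 : x / ((a + ε) ^ (1 - θ) * (b + ε) ^ θ) ≤ 1 := by nlinarith
    rwa [div_le_one (by positivity)] at h4
  have hcont : Filter.Tendsto (fun ε : ℝ => (a + ε) ^ (1 - θ) * (b + ε) ^ θ)
      (nhdsWithin 0 (Set.Ioi 0)) (nhds ((a + 0) ^ (1 - θ) * (b + 0) ^ θ)) := by
    apply Filter.Tendsto.mono_left _ nhdsWithin_le_nhds
    have : Continuous (fun ε : ℝ => (a + ε) ^ (1 - θ) * (b + ε) ^ θ) :=
      ((continuous_const.add continuous_id).rpow_const fun _ => Or.inr h1θ.le).mul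
        ((continuous_const.add continuous_id).rpow_const fun _ => Or.inr hθ.le)
    exact this.tendsto 0
  simp only [add_zero] at hcont
  exact ge_of_tendsto hcont (Filter.eventually_of_mem self_mem_nhdsWithin fun ε hε => key ε hε)

end Scalar

section StripFunctions

/-- Bounded continuous functions on the closed strip, holomorphic inside. -/
def StripFun (f : ℂ → ℂ) : Prop :=
  ContinuousOn f Strip ∧ DifferentiableOn ℂ f OStrip ∧ ∃ B : ℝ, ∀ z ∈ Strip, ‖f z‖ ≤ B

theorem StripFun.const (c : ℂ) : StripFun fun _ => c :=
  ⟨continuousOn_const, differentiableOn_const c, ‖c‖, fun _ _ => le_rfl⟩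

theorem StripFun.mul {f g : ℂ → ℂ} (hf : StripFun f) (hg : StripFun g) :
    StripFun fun z => f z * g z := by
  obtain ⟨hf1, hf2, B, hB⟩ := hf
  obtain ⟨hg1, hg2, C, hC⟩ := hg
  refine ⟨hf1.mul hg1, hf2.mul hg2, B * C, fun z hz => ?_⟩
  rw [norm_mul]
  exact mul_le_mul (hB z hz) (hC z hz) (norm_nonneg _) ((norm_nonneg _).trans (hB z hz))

theorem StripFun.sum {α : Type*} (s : Finset α) {f : α → ℂ → ℂ} (hf : ∀ i, StripFun (f i)) :
    StripFun fun z => ∑ i ∈ s, f i z := by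
  choose hf1 hf2 B hB using hf
  refine ⟨continuousOn_finsetSum _ fun i _ => hf1 i, DifferentiableOn.fun_sum fun i _ => hf2 i,
    ∑ i ∈ s, B i, fun z hz => (norm_sum_le _ _).trans (Finset.sum_le_sum fun i _ => hB i z hz)⟩

theorem StripFun.cpow {r : ℝ} (hr : 0 < r) (θ : ℝ) : StripFun fun z => (r : ℂ) ^ (z - θ) := by
  have hd : Differentiable ℂ fun z : ℂ => (r : ℂ) ^ (z - θ) :=
    (differentiable_id.sub_const _).const_cpow (Or.inl (by exact_mod_cast hr.ne'))
  refine ⟨hd.continuous.continuousOn, hd.differentiableOn, max (r ^ (-θ)) (r ^ (1 - θ)),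
    fun z hz => ?_⟩
  rw [Complex.norm_cpow_eq_rpow_re_of_pos hr]
  simp only [Complex.sub_re, Complex.ofReal_re]
  rcases le_total 1 r with h | h
  · exact le_max_of_le_right (Real.rpow_le_rpow_of_exponent_le h (by linarith [hz.2]))
  · exact le_max_of_le_left (Real.rpow_le_rpow_of_exponent_ge hr h (by linarith [hz.1]))

theorem norm_cpow_left {r : ℝ} (hr : 0 < r) (θ t : ℝ) :
    ‖(r : ℂ) ^ (Complex.I * t - θ)‖ = r ^ (-θ) := by
  rw [Complex.norm_cpow_eq_rpow_re_of_pos hr]; simp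

theorem norm_cpow_right {r : ℝ} (hr : 0 < r) (θ t : ℝ) :
    ‖(r : ℂ) ^ (1 + Complex.I * t - θ)‖ = r ^ (1 - θ) := by
  rw [Complex.norm_cpow_eq_rpow_re_of_pos hr]; simp

/-- The three lines theorem with equal bounds on both boundary lines. -/
theorem StripFun.norm_le {f : ℂ → ℂ} (hf : StripFun f) {c θ : ℝ} (hθ : 0 < θ) (hθ1 : θ < 1)
    (h0 : ∀ t : ℝ, ‖f (Complex.I * t)‖ ≤ c) (h1 : ∀ t : ℝ, ‖f (1 + Complex.I * t)‖ ≤ c) :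
    ‖f θ‖ ≤ c := by
  obtain ⟨hc, hd, B, hB⟩ := hf
  have hcl : closure (Complex.re ⁻¹' Set.Ioo 0 1) = Strip := by
    rw [Complex.closure_preimage_re, closure_Ioo zero_ne_one]; rfl
  refine PhragmenLindelof.vertical_strip (a := 0) (b := 1) ⟨hd, by rw [hcl]; exact hc⟩ ?_ ?_ ?_
    (by simpa using hθ.le) (by simpa using hθ1.le)
  · refine ⟨0, by simp [Real.pi_pos], 0, ?_⟩
    refine Asymptotics.IsBigO.of_bound B ?_
    refine Filter.eventually_inf_principal.2 (Filter.Eventually.of_forall fun z hz => ?_)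
    simpa using hB z ⟨hz.1.le, hz.2.le⟩
  · intro z hz
    have := h0 z.im
    rwa [show Complex.I * z.im = z from Complex.ext (by simp [hz]) (by simp)] at this
  · intro z hz
    have := h1 z.im
    rwa [show 1 + Complex.I * z.im = z from Complex.ext (by simp [hz]) (by simp)] at this

end StripFunctions

section Interpolation

variable {D : Type*} [AddCommGroup D] [Module ℂ D] {θ : ℝ} {N₀ N₁ : D → ℝ}

theorem interpN_le (hN : ∀ x, 0 ≤ N₀ x) {κ : Type*} [Fintype κ] (φ : κ → ℂ → ℂ) (v : κ → D)
    (hφ : ∀ i, StripFun (φ i)) {x : D} (hx : ∑ i, φ i (θ : ℂ) • v i = x) {c : ℝ}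
    (h0 : ∀ t : ℝ, N₀ (∑ i, φ i (Complex.I * t) • v i) ≤ c)
    (h1 : ∀ t : ℝ, N₁ (∑ i, φ i (1 + Complex.I * t) • v i) ≤ c) : interpN θ N₀ N₁ x ≤ c := by
  have e := (Fintype.equivFin κ).symm
  have hs : ∀ z, ∑ i, φ (e i) z • v (e i) = ∑ i, φ i z • v i := fun z =>
    e.sum_comp fun i => φ i z • v i
  refine csInf_le ⟨0, ?_⟩ ⟨_, fun i => φ (e i), fun i => v (e i), fun i => (hφ _).1,
    fun i => (hφ _).2.1, fun i => (hφ _).2.2, by rw [hs, hx], fun t => by rw [hs]; exact h0 t,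
    fun t => by rw [hs]; exact h1 t⟩
  rintro r ⟨m, φ, v, -, -, -, -, h, -⟩
  exact (hN _).trans (h 0)

theorem exists_of_interpN_lt {x : D} {c : ℝ} (h : interpN θ N₀ N₁ x < c) :
    ∃ (m : ℕ) (φ : Fin m → ℂ → ℂ) (v : Fin m → D), (∀ i, StripFun (φ i)) ∧
      ∑ i, φ i (θ : ℂ) • v i = x ∧ (∀ t : ℝ, N₀ (∑ i, φ i (Complex.I * t) • v i) ≤ c) ∧
      ∀ t : ℝ, N₁ (∑ i, φ i (1 + Complex.I * t) • v i) ≤ c := by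
  unfold interpN at h
  obtain ⟨r, ⟨m, φ, v, h1, h2, h3, h4, h5, h6⟩, hr⟩ := exists_lt_of_csInf_lt (by
    refine ⟨max (N₀ x) (N₁ x), 1, fun _ _ => 1, fun _ => x, fun _ => (StripFun.const 1).1,
      fun _ => (StripFun.const 1).2.1, fun _ => (StripFun.const 1).2.2, ?_, fun t => ?_,
      fun t => ?_⟩ <;> simp) h
  exact ⟨m, φ, v, fun i => ⟨h1 i, h2 i, h3 i⟩, h4, fun t => (h5 t).trans hr.le,
    fun t => (h6 t).trans hr.le⟩

theorem interpN_nonneg (hN : ∀ x, 0 ≤ N₀ x) (x : D) : 0 ≤ interpN θ N₀ N₁ x := by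
  refine Real.sInf_nonneg ?_
  rintro r ⟨m, φ, v, -, -, -, -, h, -⟩
  exact (hN _).trans (h 0)

theorem interpN_le_max (hN : ∀ x, 0 ≤ N₀ x) (x : D) :
    interpN θ N₀ N₁ x ≤ max (N₀ x) (N₁ x) :=
  interpN_le hN (κ := Unit) (fun _ _ => 1) (fun _ => x) (fun _ => StripFun.const 1) (by simp)
    (by simp) (by simp)

/-- The interpolation functional of two seminorms, as a seminorm. -/
def interpSeminorm (θ : ℝ) (N₀ N₁ : Seminorm ℂ D) : Seminorm ℂ D :=
  Seminorm.ofSMulLE (interpN θ N₀ N₁)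
    (le_antisymm ((interpN_le_max (apply_nonneg N₀) 0).trans (by simp))
      (interpN_nonneg (apply_nonneg N₀) 0))
    (fun x y => by
      refine le_of_forall_pos_le_add fun ε hε => ?_
      obtain ⟨m, φ, v, hφ, hx, h0, h1⟩ := exists_of_interpN_lt
        (show interpN θ N₀ N₁ x < interpN θ N₀ N₁ x + ε / 2 by linarith)
      obtain ⟨m', φ', v', hφ', hx', h0', h1'⟩ := exists_of_interpN_lt
        (show interpN θ N₀ N₁ y < interpN θ N₀ N₁ y + ε / 2 by linarith)
      refine interpN_le (apply_nonneg N₀) (κ := Fin m ⊕ Fin m') (Sum.elim φ φ') (Sum.elim v v')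
        (by rintro (i | i); exacts [hφ i, hφ' i]) ?_ (fun t => ?_) (fun t => ?_)
      · simp [hx, hx']
      · simp only [Fintype.sum_sum_type, Sum.elim_inl, Sum.elim_inr]
        exact (map_add_le_add N₀ _ _).trans (by linarith [h0 t, h0' t])
      · simp only [Fintype.sum_sum_type, Sum.elim_inl, Sum.elim_inr]
        exact (map_add_le_add N₁ _ _).trans (by linarith [h1 t, h1' t]))
    (fun c x => by
      refine le_of_forall_pos_le_add fun ε hε => ?_
      obtain ⟨δ, hδ, hδε⟩ : ∃ δ > 0, ‖c‖ * δ ≤ ε :=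
        ⟨ε / (‖c‖ + 1), by positivity, by
          rw [← mul_div_assoc, div_le_iff₀ (by positivity)]; nlinarith [norm_nonneg c]⟩
      obtain ⟨m, φ, v, hφ, hx, h0, h1⟩ := exists_of_interpN_lt
        (show interpN θ N₀ N₁ x < interpN θ N₀ N₁ x + δ by linarith)
      have hs : ∀ z, ∑ i, φ i z • c • v i = c • ∑ i, φ i z • v i := fun z => by
        simp_rw [smul_comm _ c, Finset.smul_sum]
      refine interpN_le (apply_nonneg N₀) φ (fun i => c • v i) hφ (by rw [hs, hx])
        (fun t => ?_) (fun t => ?_)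
      · rw [hs, map_smul_eq_mul]
        have := mul_le_mul_of_nonneg_left (h0 t) (norm_nonneg c)
        linarith
      · rw [hs, map_smul_eq_mul]
        have := mul_le_mul_of_nonneg_left (h1 t) (norm_nonneg c)
        linarith)

theorem interpSeminorm_apply (N₀ N₁ : Seminorm ℂ D) (x : D) :
    interpSeminorm θ N₀ N₁ x = interpN θ N₀ N₁ x := rfl

end Interpolation

section Injective

variable {V W : Type*} [AddCommGroup V] [Module ℂ V] [AddCommGroup W] [Module ℂ W]

/-- The functional `φ ⊗ ψ` on the tensor product. -/
def tensFun (φ : V →ₗ[ℂ] ℂ) (ψ : W →ₗ[ℂ] ℂ) : TensorProduct ℂ V W →ₗ[ℂ] ℂ :=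
  TensorProduct.lift (((LinearMap.mul ℂ ℂ).comp φ).compl₂ ψ)

@[simp]
theorem tensFun_tmul (φ : V →ₗ[ℂ] ℂ) (ψ : W →ₗ[ℂ] ℂ) (x : V) (y : W) :
    tensFun φ ψ (TensorProduct.tmul ℂ x y) = φ x * ψ y := rfl

theorem injN_le {NV : V → ℝ} {NW : W → ℝ} (hV : ∀ x, 0 ≤ NV x) (hW : ∀ x, 0 ≤ NW x)
    {z : TensorProduct ℂ V W} {c : ℝ}
    (h : ∀ (φ : V →ₗ[ℂ] ℂ) (ψ : W →ₗ[ℂ] ℂ), (∀ x, ‖φ x‖ ≤ NV x) → (∀ y, ‖ψ y‖ ≤ NW y) →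
      ‖tensFun φ ψ z‖ ≤ c) : injN NV NW z ≤ c := by
  refine csSup_le ⟨_, 0, 0, by simpa using hV, by simpa using hW, rfl⟩ ?_
  rintro r ⟨φ, ψ, hφ, hψ, rfl⟩
  exact h φ ψ hφ hψ

theorem le_injN {NV : V → ℝ} {NW : W → ℝ} (z : TensorProduct ℂ V W)
    {φ : V →ₗ[ℂ] ℂ} {ψ : W →ₗ[ℂ] ℂ} (hφ : ∀ x, ‖φ x‖ ≤ NV x) (hψ : ∀ y, ‖ψ y‖ ≤ NW y) :
    ‖tensFun φ ψ z‖ ≤ injN NV NW z := by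
  refine le_csSup ?_ ⟨φ, ψ, hφ, hψ, rfl⟩
  suffices ∃ B, ∀ (φ : V →ₗ[ℂ] ℂ) (ψ : W →ₗ[ℂ] ℂ), (∀ x, ‖φ x‖ ≤ NV x) →
      (∀ y, ‖ψ y‖ ≤ NW y) → ‖tensFun φ ψ z‖ ≤ B by
    obtain ⟨B, hB⟩ := this
    refine ⟨B, ?_⟩
    rintro r ⟨φ, ψ, hφ, hψ, rfl⟩
    exact hB φ ψ hφ hψ
  induction z using TensorProduct.induction_on with
  | zero => exact ⟨0, fun φ ψ _ _ => by simp⟩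
  | tmul x y =>
    refine ⟨NV x * NW y, fun φ ψ hφ hψ => ?_⟩
    rw [tensFun_tmul, norm_mul]
    exact mul_le_mul (hφ x) (hψ y) (norm_nonneg _) ((norm_nonneg _).trans (hφ x))
  | add a b ha hb =>
    obtain ⟨A, hA⟩ := ha
    obtain ⟨B, hB⟩ := hb
    refine ⟨A + B, fun φ ψ hφ hψ => ?_⟩
    rw [map_add]
    exact (norm_add_le _ _).trans (add_le_add (hA φ ψ hφ hψ) (hB φ ψ hφ hψ))

theorem injN_nonneg {NV : V → ℝ} {NW : W → ℝ} (z : TensorProduct ℂ V W) : 0 ≤ injN NV NW z := by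
  refine Real.sSup_nonneg ?_
  rintro r ⟨φ, ψ, -, -, rfl⟩
  exact norm_nonneg _

end Injective

section GoodSets

variable {ι : Type*}

/-- A bounded set of nonnegative vectors containing a strictly positive one, whose convex hull is
dominated by `M` times the set. -/
structure GoodSet (M : ℝ) (P : Set (ι → ℝ)) : Prop where
  nonneg : ∀ p ∈ P, ∀ i, 0 ≤ p i
  bdd : ∃ b : ℝ, ∀ p ∈ P, ∀ i, p i ≤ b
  pos : ∃ p ∈ P, ∀ i, 0 < p i
  conv : ∀ p ∈ convexHull ℝ P, ∃ p' ∈ P, ∀ i, p i ≤ M * p' i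

/-- The vectors dominated by an element of the convex hull of `P`. -/
def lowerHull (P : Set (ι → ℝ)) : Set (ι → ℝ) :=
  {v | ∃ p ∈ convexHull ℝ P, ∀ i, v i ≤ p i}

theorem convex_lowerHull (P : Set (ι → ℝ)) : Convex ℝ (lowerHull P) := by
  rintro u ⟨p, hp, hup⟩ v ⟨q, hq, hvq⟩ a b ha hb hab
  exact ⟨a • p + b • q, convex_convexHull ℝ P hp hq ha hb hab, fun i => add_le_add
    (mul_le_mul_of_nonneg_left (hup i) ha) (mul_le_mul_of_nonneg_left (hvq i) hb)⟩

variable {M : ℝ} {P : Set (ι → ℝ)}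

theorem GoodSet.exists_abs_le [Fintype ι] (hP : GoodSet M P) (v : ι → ℝ) :
    ∃ p ∈ P, ∃ t : ℝ, 0 < t ∧ ∀ i, |v i| ≤ t * p i := by
  obtain ⟨p, hp, hpos⟩ := hP.pos
  have h0 : ∀ i ∈ Finset.univ, 0 ≤ |v i| / p i := fun i _ => by have := hpos i; positivity
  refine ⟨p, hp, ∑ i, |v i| / p i + 1, by linarith [Finset.sum_nonneg h0], fun i => ?_⟩
  have := Finset.single_le_sum h0 (Finset.mem_univ i)
  rw [div_le_iff₀ (hpos i)] at this
  nlinarith [hpos i]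

theorem GoodSet.absorbent [Fintype ι] (hP : GoodSet M P) : Absorbent ℝ (lowerHull P) := by
  intro v
  rw [absorbs_iff_norm]
  obtain ⟨q, hq, s, hs, hvq⟩ := hP.exists_abs_le v
  refine ⟨s, fun c hc => ?_⟩
  have hc0 : c ≠ 0 := by rintro rfl; simp at hc; linarith
  rw [Set.singleton_subset_iff, Set.mem_smul_set_iff_inv_smul_mem₀ hc0]
  refine ⟨q, subset_convexHull ℝ P hq, fun i => ?_⟩
  simp only [Pi.smul_apply, smul_eq_mul]
  refine (le_abs_self _).trans ?_
  rw [abs_mul, abs_inv, inv_mul_le_iff₀ (abs_pos.2 hc0)]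
  exact (hvq i).trans (mul_le_mul_of_nonneg_right (by simpa using hc) (hP.nonneg q hq i))

/-- The gauge of the lower hull. -/
def hullGauge (P : Set (ι → ℝ)) (v : ι → ℝ) : ℝ := gauge (lowerHull P) v

theorem GoodSet.hullGauge_add_le [Fintype ι] (hP : GoodSet M P) (u v : ι → ℝ) :
    hullGauge P (u + v) ≤ hullGauge P u + hullGauge P v :=
  gauge_add_le (convex_lowerHull P) hP.absorbent u v

theorem hullGauge_smul {c : ℝ} (hc : 0 < c) (v : ι → ℝ) :
    hullGauge P (c • v) = c * hullGauge P v := by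
  exact gauge_smul_of_nonneg (s := lowerHull P) hc.le v

theorem hullGauge_nonneg (v : ι → ℝ) : 0 ≤ hullGauge P v := gauge_nonneg v

theorem hullGauge_zero : hullGauge P 0 = 0 := gauge_zero

theorem hullGauge_le_one {p : ι → ℝ} (hp : p ∈ P) : hullGauge P p ≤ 1 :=
  gauge_le_one_of_mem ⟨p, subset_convexHull ℝ P hp, fun _ => le_rfl⟩

theorem GoodSet.hullGauge_of_nonpos (hP : GoodSet M P) {v : ι → ℝ} (hv : ∀ i, v i ≤ 0) :
    hullGauge P v ≤ 0 := by
  refine le_of_forall_pos_le_add fun ε hε => ?_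
  rw [zero_add]
  refine gauge_le_of_mem hε.le ?_
  rw [Set.mem_smul_set_iff_inv_smul_mem₀ hε.ne']
  obtain ⟨p, hp, -⟩ := hP.pos
  refine ⟨p, subset_convexHull ℝ P hp, fun i => le_trans ?_ (hP.nonneg p hp i)⟩
  exact mul_nonpos_of_nonneg_of_nonpos (inv_pos.2 hε).le (hv i)

theorem GoodSet.exists_le_of_hullGauge_lt [Fintype ι] (hP : GoodSet M P) {v : ι → ℝ} {T : ℝ}
    (hv : hullGauge P v < T) : ∃ p ∈ P, ∀ i, v i ≤ T * (M * p i) := by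
  obtain ⟨b, hb, hbT, w, ⟨p, hp, hwp⟩, rfl⟩ := exists_lt_of_gauge_lt hP.absorbent hv
  obtain ⟨p', hp', hpp⟩ := hP.conv p hp
  refine ⟨p', hp', fun i => ?_⟩
  have h0 : 0 ≤ p i := by
    have : convexHull ℝ P ⊆ {v | 0 ≤ v i} := convexHull_min (fun v hv => hP.nonneg v hv i)
      (convex_halfSpace_ge (LinearMap.isLinear (LinearMap.proj (R := ℝ) i)) 0)
    exact this hp
  calc b * w i ≤ b * p i := mul_le_mul_of_nonneg_left (hwp i) hb.le
    _ ≤ T * p i := mul_le_mul_of_nonneg_right hbT.le h0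
    _ ≤ T * (M * p' i) := mul_le_mul_of_nonneg_left (hpp i) (hb.trans hbT).le

end GoodSets

section Factorization

variable {ι κ : Type*} [Fintype ι] [Fintype κ]

/-- The bilinear form with matrix `z`. -/
def matForm (z : ι → κ → ℂ) (φ : ι → ℂ) (ψ : κ → ℂ) : ℂ := ∑ i, ∑ j, z i j * (φ i * ψ j)

theorem matForm_smul_left (z : ι → κ → ℂ) (c : ℂ) (φ : ι → ℂ) (ψ : κ → ℂ) :
    matForm z (c • φ) ψ = c * matForm z φ ψ := by
  simp only [matForm, Finset.mul_sum, Pi.smul_apply, smul_eq_mul]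
  exact Finset.sum_congr rfl fun i _ => Finset.sum_congr rfl fun j _ => by ring

theorem exists_normalized {α K : Type*} [Fintype K] (c : K → ℝ) (hc : ∀ k, 0 ≤ c k)
    (φ : K → α → ℂ) (ξ : α → ℝ) {T : ℝ} (hT : 0 < T)
    (hφ : ∀ i, ∑ k, c k * ‖φ k i‖ ^ 2 ≤ T * ξ i ^ 2) :
    ∃ x : α → K → ℂ, (∀ i, ∑ k, ‖x i k‖ ^ 2 ≤ 1) ∧
      ∀ i k, (√T * ξ i : ℂ) * x i k = √(c k) * φ k i := by
  refine ⟨fun i k => √(c k) * φ k i / (√T * ξ i), fun i => ?_, fun i k => ?_⟩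
  · have : ∀ k, ‖(√(c k) * φ k i / (√T * ξ i) : ℂ)‖ ^ 2 =
        c k * ‖φ k i‖ ^ 2 / (T * ξ i ^ 2) := fun k => by
      rw [norm_div, norm_mul, norm_mul, div_pow, mul_pow, mul_pow]
      simp only [Complex.norm_real, Real.norm_eq_abs, sq_abs, Real.sq_sqrt (hc k),
        Real.sq_sqrt hT.le]
    simp_rw [this, ← Finset.sum_div]
    exact div_le_one_of_le₀ (hφ i) (by positivity)
  · by_cases h : ξ i = 0
    · have h1 := hφ i
      rw [h] at h1
      have h2 : c k * ‖φ k i‖ ^ 2 ≤ 0 := (Finset.single_le_sum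
        (f := fun k => c k * ‖φ k i‖ ^ 2) (fun k _ => mul_nonneg (hc k) (by positivity))
        (Finset.mem_univ k)).trans (h1.trans (by simp))
      have h3 : c k * ‖φ k i‖ ^ 2 = 0 := le_antisymm h2 (mul_nonneg (hc k) (by positivity))
      rcases mul_eq_zero.1 h3 with h4 | h4
      · simp [h4, h]
      · simp [norm_eq_zero.1 (pow_eq_zero_iff two_ne_zero |>.1 h4), h]
    · have h1 : (ξ i : ℂ) ≠ 0 := by exact_mod_cast h
      have h2 : ((√T : ℝ) : ℂ) ≠ 0 := by exact_mod_cast (Real.sqrt_pos.2 hT).ne'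
      field_simp

theorem norm_sum_matForm_le (z : ι → κ → ℂ) (ξ : ι → ℝ) (η : κ → ℝ) {I T U : ℝ} (hT : 0 < T)
    (hU : 0 < U)
    (hz : ∀ (s : ι → ℂ) (t : κ → ℂ), (∀ i, ‖s i‖ ≤ 1) → (∀ j, ‖t j‖ ≤ 1) →
      ‖matForm z (fun i => ξ i * s i) (fun j => η j * t j)‖ ≤ I)
    {K : Type*} [Fintype K] (c : K → ℝ) (hc : ∀ k, 0 ≤ c k) (φ : K → ι → ℂ) (ψ : K → κ → ℂ)
    (hφ : ∀ i, ∑ k, c k * ‖φ k i‖ ^ 2 ≤ T * ξ i ^ 2)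
    (hψ : ∀ j, ∑ k, c k * ‖ψ k j‖ ^ 2 ≤ U * η j ^ 2) :
    ‖∑ k, (c k : ℂ) * matForm z (φ k) (ψ k)‖ ≤ 108 * (I * (√T * √U)) := by
  obtain ⟨x, hx, hx'⟩ := exists_normalized c hc φ ξ hT hφ
  obtain ⟨y, hy, hy'⟩ := exists_normalized c hc ψ η hU hψ
  have hG := grothendieck_inequality (fun i j => z i j * ((√T * ξ i) * (√U * η j)))
    (I * (√T * √U)) (fun s t hs ht => by
      have h1 : ∑ i, ∑ j, z i j * ((√T * ξ i) * (√U * η j)) * (s i * t j) =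
          (√T * √U : ℂ) * matForm z (fun i => ξ i * s i) (fun j => η j * t j) := by
        simp only [matForm, Finset.mul_sum]
        exact Finset.sum_congr rfl fun i _ => Finset.sum_congr rfl fun j _ => by ring
      rw [h1, norm_mul, norm_mul, Complex.norm_real, Complex.norm_real,
        Real.norm_of_nonneg (Real.sqrt_nonneg _), Real.norm_of_nonneg (Real.sqrt_nonneg _),
        mul_comm]
      exact mul_le_mul_of_nonneg_right (hz s t hs ht) (by positivity)) x y hx hy
  refine le_trans (le_of_eq (congrArg _ ?_)) hG
  have h2 : ∀ i j, z i j * ((√T * ξ i) * (√U * η j)) * ∑ k, x i k * y j k =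
      ∑ k, (c k : ℂ) * (z i j * (φ k i * ψ k j)) := fun i j => by
    rw [Finset.mul_sum]
    refine Finset.sum_congr rfl fun k _ => ?_
    have h3 : ((√(c k) : ℝ) : ℂ) * (√(c k) : ℝ) = (c k : ℝ) := by
      rw [← Complex.ofReal_mul, Real.mul_self_sqrt (hc k)]
    calc z i j * ((√T * ξ i) * (√U * η j)) * (x i k * y j k)
        = z i j * (((√T * ξ i) * x i k) * ((√U * η j) * y j k)) := by ring
      _ = z i j * ((√(c k) * φ k i) * (√(c k) * ψ k j)) := by rw [hx', hy']
      _ = (√(c k) * √(c k)) * (z i j * (φ k i * ψ k j)) := by ring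
      _ = _ := by rw [h3]
  simp only [vecForm, matForm]
  simp_rw [h2]
  rw [Finset.sum_congr rfl fun k _ => Finset.mul_sum _ _ _, Finset.sum_comm]
  refine Finset.sum_congr rfl fun i _ => ?_
  rw [Finset.sum_congr rfl fun k _ => Finset.mul_sum _ _ _, Finset.sum_comm]

variable {θ : ℝ}

/-- The vectors whose squares lie below the Calderón product of `P₀` and `P₁`. -/
def calderonBall (θ : ℝ) (P₀ P₁ : Set (ι → ℝ)) : Set (ι → ℂ) :=
  {φ | ∃ p₀ ∈ P₀, ∃ p₁ ∈ P₁, ∀ i, ‖φ i‖ ^ 2 ≤ p₀ i ^ (1 - θ) * p₁ i ^ θ}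

theorem exists_calderon_root (hθ : 0 < θ) (hθ1 : θ < 1) {M : ℝ} (hM : 0 < M)
    {P₀ P₁ : Set (ι → ℝ)} (h₀ : GoodSet M P₀) (h₁ : GoodSet M P₁)
    {K : Type*} [Fintype K] (c : K → ℝ) (hc : ∀ k, 0 ≤ c k) (φ : K → ι → ℂ) (p₀ p₁ : K → ι → ℝ)
    (hp₀ : ∀ k i, 0 ≤ p₀ k i) (hp₁ : ∀ k i, 0 ≤ p₁ k i)
    (hφ : ∀ k i, ‖φ k i‖ ^ 2 ≤ p₀ k i ^ (1 - θ) * p₁ k i ^ θ) {T₀ T₁ : ℝ}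
    (hT₀ : hullGauge P₀ (∑ k, c k • p₀ k) < T₀) (hT₁ : hullGauge P₁ (∑ k, c k • p₁ k) < T₁) :
    ∃ ξ : ι → ℝ, (∀ s : ι → ℂ, (∀ i, ‖s i‖ ≤ 1) → (fun i => ξ i * s i) ∈ calderonBall θ P₀ P₁) ∧
      ∀ i, ∑ k, c k * ‖φ k i‖ ^ 2 ≤ (M * (T₀ ^ (1 - θ) * T₁ ^ θ)) * ξ i ^ 2 := by
  have hT₀' := (hullGauge_nonneg _).trans_lt hT₀
  have hT₁' := (hullGauge_nonneg _).trans_lt hT₁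
  obtain ⟨q₀, hq₀, hle₀⟩ := h₀.exists_le_of_hullGauge_lt hT₀
  obtain ⟨q₁, hq₁, hle₁⟩ := h₁.exists_le_of_hullGauge_lt hT₁
  have hq₀' := h₀.nonneg q₀ hq₀
  have hq₁' := h₁.nonneg q₁ hq₁
  have hξ : ∀ i, √(q₀ i ^ (1 - θ) * q₁ i ^ θ) ^ 2 = q₀ i ^ (1 - θ) * q₁ i ^ θ := fun i =>
    Real.sq_sqrt (mul_nonneg (Real.rpow_nonneg (hq₀' i) _) (Real.rpow_nonneg (hq₁' i) _))
  refine ⟨fun i => √(q₀ i ^ (1 - θ) * q₁ i ^ θ), fun s hs => ⟨q₀, hq₀, q₁, hq₁, fun i => ?_⟩,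
    fun i => ?_⟩
  · rw [norm_mul, mul_pow, Complex.norm_real, Real.norm_eq_abs, sq_abs, hξ]
    refine mul_le_of_le_one_right (mul_nonneg (Real.rpow_nonneg (hq₀' i) _)
      (Real.rpow_nonneg (hq₁' i) _)) (pow_le_one₀ (norm_nonneg _) (hs i))
  · rw [hξ]
    have e₀ := hle₀ i
    have e₁ := hle₁ i
    simp only [Finset.sum_apply, Pi.smul_apply, smul_eq_mul] at e₀ e₁
    calc ∑ k, c k * ‖φ k i‖ ^ 2 ≤ ∑ k, c k * (p₀ k i ^ (1 - θ) * p₁ k i ^ θ) :=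
          Finset.sum_le_sum fun k _ => mul_le_mul_of_nonneg_left (hφ k i) (hc k)
      _ ≤ (∑ k, c k * p₀ k i) ^ (1 - θ) * (∑ k, c k * p₁ k i) ^ θ :=
          sum_mul_rpow_mul_rpow_le _ hθ hθ1 _ _ _ hc (fun k => hp₀ k i) (fun k => hp₁ k i)
      _ ≤ (T₀ * (M * q₀ i)) ^ (1 - θ) * (T₁ * (M * q₁ i)) ^ θ := by
          have n₀ : 0 ≤ ∑ k, c k * p₀ k i :=
            Finset.sum_nonneg fun k _ => mul_nonneg (hc k) (hp₀ k i)
          have n₁ : 0 ≤ ∑ k, c k * p₁ k i :=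
            Finset.sum_nonneg fun k _ => mul_nonneg (hc k) (hp₁ k i)
          have := hq₀' i
          exact mul_le_mul (Real.rpow_le_rpow n₀ e₀ (by linarith)) (Real.rpow_le_rpow n₁ e₁ hθ.le)
            (Real.rpow_nonneg n₁ _) (by positivity)
      _ = (M ^ (1 - θ) * M ^ θ) * (T₀ ^ (1 - θ) * T₁ ^ θ) * (q₀ i ^ (1 - θ) * q₁ i ^ θ) := by
          rw [Real.mul_rpow hT₀'.le (mul_nonneg hM.le (hq₀' i)), Real.mul_rpow hM.le (hq₀' i),
            Real.mul_rpow hT₁'.le (mul_nonneg hM.le (hq₁' i)), Real.mul_rpow hM.le (hq₁' i)]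
          ring
      _ = _ := by
          rw [← Real.rpow_add hM]; simp

end Factorization

section Factorization

variable {ι κ : Type*} [Fintype ι] [Fintype κ] {θ : ℝ}

theorem GoodSet.exists_weights {M w : ℝ} (hw : 0 < w) {P : Set (ι → ℝ)} (hP : GoodSet M P)
    (L : (ι → ℝ) →ₗ[ℝ] ℝ) (hL : ∀ v, L v ≤ w * hullGauge P v) :
    ∃ A : ι → ℝ, (∀ i, 0 ≤ A i) ∧ (∀ p ∈ P, ∑ i, A i * p i ≤ 1) ∧
      ∀ v, L v = w * ∑ i, A i * v i := by
  classical
  have hv : ∀ v, L v = w * ∑ i, (w⁻¹ * L (Pi.single i 1)) * v i := fun v => by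
    rw [LinearMap.pi_apply_eq_sum_univ L v, Finset.mul_sum]
    refine Finset.sum_congr rfl fun i _ => ?_
    have : (fun j => if i = j then (1 : ℝ) else 0) = Pi.single i 1 := by
      ext j; simp [Pi.single_apply, eq_comm]
    rw [this, smul_eq_mul]
    field_simp
  refine ⟨fun i => w⁻¹ * L (Pi.single i 1), fun i => ?_, fun p hp => ?_, hv⟩
  · have h1 := hL (-Pi.single i 1)
    have h2 := hP.hullGauge_of_nonpos (v := -Pi.single i 1) fun j => by
      by_cases h : j = i
      · subst h; simp
      · simp [h]
    rw [map_neg] at h1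
    have h3 : 0 ≤ L (Pi.single i 1) := by nlinarith
    positivity
  · have h1 := (hL p).trans (mul_le_mul_of_nonneg_left (hullGauge_le_one hp) hw.le)
    rw [hv, mul_le_mul_iff_right₀ hw] at h1
    exact h1

theorem exists_weights_of_matForm (hθ : 0 < θ) (hθ1 : θ < 1) {M I : ℝ} (hM : 0 < M) (hI : 0 < I)
    {P₀ P₁ : Set (ι → ℝ)} {Q₀ Q₁ : Set (κ → ℝ)} (hP₀ : GoodSet M P₀) (hP₁ : GoodSet M P₁)
    (hQ₀ : GoodSet M Q₀) (hQ₁ : GoodSet M Q₁) (z : ι → κ → ℂ)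
    (hz : ∀ φ ∈ calderonBall θ P₀ P₁, ∀ ψ ∈ calderonBall θ Q₀ Q₁, ‖matForm z φ ψ‖ ≤ I) :
    ∃ (A₀ A₁ : ι → ℝ) (B₀ B₁ : κ → ℝ),
      ((∀ i, 0 ≤ A₀ i) ∧ ∀ p ∈ P₀, ∑ i, A₀ i * p i ≤ 1) ∧
      ((∀ i, 0 ≤ A₁ i) ∧ ∀ p ∈ P₁, ∑ i, A₁ i * p i ≤ 1) ∧
      ((∀ j, 0 ≤ B₀ j) ∧ ∀ q ∈ Q₀, ∑ j, B₀ j * q j ≤ 1) ∧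
      ((∀ j, 0 ≤ B₁ j) ∧ ∀ q ∈ Q₁, ∑ j, B₁ j * q j ≤ 1) ∧
      ∀ (φ : ι → ℂ) (ψ : κ → ℂ) (p₀ p₁ : ι → ℝ) (q₀ q₁ : κ → ℝ),
        (∀ i, 0 ≤ p₀ i ∧ 0 ≤ p₁ i ∧ ‖φ i‖ ^ 2 ≤ p₀ i ^ (1 - θ) * p₁ i ^ θ) →
        (∀ j, 0 ≤ q₀ j ∧ 0 ≤ q₁ j ∧ ‖ψ j‖ ^ 2 ≤ q₀ j ^ (1 - θ) * q₁ j ^ θ) →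
        (matForm z φ ψ).re ≤ 108 * (M * I) *
          ((1 - θ) * (∑ i, A₀ i * p₀ i) + θ * (∑ i, A₁ i * p₁ i) +
            ((1 - θ) * (∑ j, B₀ j * q₀ j) + θ * (∑ j, B₁ j * q₁ j))) := by
  have h1θ : 0 < 1 - θ := by linarith
  let S := {w : ((ι → ℂ) × (κ → ℂ)) × (((ι → ℝ) × (ι → ℝ)) × ((κ → ℝ) × (κ → ℝ))) //
    (∀ i, 0 ≤ w.2.1.1 i ∧ 0 ≤ w.2.1.2 i ∧
      ‖w.1.1 i‖ ^ 2 ≤ w.2.1.1 i ^ (1 - θ) * w.2.1.2 i ^ θ) ∧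
    (∀ j, 0 ≤ w.2.2.1 j ∧ 0 ≤ w.2.2.2 j ∧
      ‖w.1.2 j‖ ^ 2 ≤ w.2.2.1 j ^ (1 - θ) * w.2.2.2 j ^ θ)}
  obtain ⟨L, hL, hs⟩ := mazur_orlicz (V := (((ι → ℝ) × (ι → ℝ)) × ((κ → ℝ) × (κ → ℝ)))) (ι := S)
    (fun v => (1 - θ) * hullGauge P₀ v.1.1 + θ * hullGauge P₁ v.1.2 +
      ((1 - θ) * hullGauge Q₀ v.2.1 + θ * hullGauge Q₁ v.2.2))
    (fun c hc v => by
      simp only [Prod.smul_fst, Prod.smul_snd, hullGauge_smul hc]; ring)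
    (fun u v => by
      have e1 := mul_le_mul_of_nonneg_left (hP₀.hullGauge_add_le u.1.1 v.1.1) h1θ.le
      have e2 := mul_le_mul_of_nonneg_left (hP₁.hullGauge_add_le u.1.2 v.1.2) hθ.le
      have e3 := mul_le_mul_of_nonneg_left (hQ₀.hullGauge_add_le u.2.1 v.2.1) h1θ.le
      have e4 := mul_le_mul_of_nonneg_left (hQ₁.hullGauge_add_le u.2.2 v.2.2) hθ.le
      simp only [Prod.fst_add, Prod.snd_add]
      linarith)
    (fun w => w.1.2) (fun w => (matForm z w.1.1.1 w.1.1.2).re / (108 * (M * I)))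
    (fun c hc => by
      have hsum : ∀ (f : S → ℝ), ∑ w ∈ c.support, f w = ∑ w : c.support, f w := fun f =>
        (Finset.sum_coe_sort c.support f).symm
      have hsumV : ∀ (f : S → ((ι → ℝ) × (ι → ℝ)) × ((κ → ℝ) × (κ → ℝ))),
          ∑ w ∈ c.support, f w = ∑ w : c.support, f w := fun f =>
        (Finset.sum_coe_sort c.support f).symm
      rw [hsum, hsumV]
      simp only [Prod.fst_sum, Prod.snd_sum, Prod.smul_fst, Prod.smul_snd]
      refine le_of_forall_pos_le_add fun ε hε => ?_
      have hlt : ∀ g : ℝ, g < g + ε / 2 := fun g => by linarith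
      set g₀ := hullGauge P₀ (∑ w : c.support, c w • w.1.1.2.1.1)
      set g₁ := hullGauge P₁ (∑ w : c.support, c w • w.1.1.2.1.2)
      set k₀ := hullGauge Q₀ (∑ w : c.support, c w • w.1.1.2.2.1)
      set k₁ := hullGauge Q₁ (∑ w : c.support, c w • w.1.1.2.2.2)
      have hg₀ : 0 < g₀ + ε / 2 := by have : 0 ≤ g₀ := hullGauge_nonneg _; linarith
      have hg₁ : 0 < g₁ + ε / 2 := by have : 0 ≤ g₁ := hullGauge_nonneg _; linarith
      have hk₀ : 0 < k₀ + ε / 2 := by have : 0 ≤ k₀ := hullGauge_nonneg _; linarith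
      have hk₁ : 0 < k₁ + ε / 2 := by have : 0 ≤ k₁ := hullGauge_nonneg _; linarith
      obtain ⟨ξ, hξ, hφ⟩ := exists_calderon_root hθ hθ1 hM hP₀ hP₁
        (fun w : c.support => c w) (fun w => hc w) (fun w => w.1.1.1.1)
        (fun w => w.1.1.2.1.1) (fun w => w.1.1.2.1.2) (fun w i => (w.1.2.1 i).1)
        (fun w i => (w.1.2.1 i).2.1) (fun w i => (w.1.2.1 i).2.2) (hlt g₀) (hlt g₁)
      obtain ⟨η, hη, hψ⟩ := exists_calderon_root hθ hθ1 hM hQ₀ hQ₁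
        (fun w : c.support => c w) (fun w => hc w) (fun w => w.1.1.1.2)
        (fun w => w.1.1.2.2.1) (fun w => w.1.1.2.2.2) (fun w i => (w.1.2.2 i).1)
        (fun w i => (w.1.2.2 i).2.1) (fun w i => (w.1.2.2 i).2.2) (hlt k₀) (hlt k₁)
      set T := (g₀ + ε / 2) ^ (1 - θ) * (g₁ + ε / 2) ^ θ
      set U := (k₀ + ε / 2) ^ (1 - θ) * (k₁ + ε / 2) ^ θ
      have hT : 0 < T := by positivity
      have hU : 0 < U := by positivity
      have hTle : T ≤ (1 - θ) * (g₀ + ε / 2) + θ * (g₁ + ε / 2) :=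
        Real.geom_mean_le_arith_mean2_weighted h1θ.le hθ.le hg₀.le hg₁.le (by ring)
      have hUle : U ≤ (1 - θ) * (k₀ + ε / 2) + θ * (k₁ + ε / 2) :=
        Real.geom_mean_le_arith_mean2_weighted h1θ.le hθ.le hk₀.le hk₁.le (by ring)
      have hG := norm_sum_matForm_le z ξ η (mul_pos hM hT) (mul_pos hM hU)
        (fun s t hs ht => hz _ (hξ s hs) _ (hη t ht)) (fun w : c.support => c w)
        (fun w => hc w) (fun w => w.1.1.1.1) (fun w => w.1.1.1.2) hφ hψ
      have hre : ∑ w : c.support, c w * ((matForm z w.1.1.1.1 w.1.1.1.2).re / (108 * (M * I))) =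
          (∑ w : c.support, (c w : ℂ) * matForm z w.1.1.1.1 w.1.1.1.2).re / (108 * (M * I)) := by
        rw [Complex.re_sum, Finset.sum_div]
        refine Finset.sum_congr rfl fun w _ => ?_
        rw [Complex.re_ofReal_mul, mul_div_assoc]
      rw [hre, div_le_iff₀ (by positivity)]
      refine ((Complex.re_le_norm _).trans hG).trans ?_
      have hsq : √(M * T) * √(M * U) ≤ M * (T + U) := by
        have := two_mul_le_add_sq (√(M * T)) (√(M * U))
        rw [Real.sq_sqrt (by positivity), Real.sq_sqrt (by positivity)] at this
        have : 0 < M * T := by positivity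
        have : 0 < M * U := by positivity
        nlinarith
      calc 108 * (I * (√(M * T) * √(M * U))) ≤ 108 * (I * (M * (T + U))) := by gcongr
        _ = (T + U) * (108 * (M * I)) := by ring
        _ ≤ _ := by
          refine mul_le_mul_of_nonneg_right ?_ (by positivity)
          linarith)
  obtain ⟨A₀, hA₀, hA₀', hA₀L⟩ := hP₀.exists_weights h1θ
    (L.comp ((LinearMap.inl ℝ _ _).comp (LinearMap.inl ℝ _ _))) (fun v => by
      simpa [hullGauge_zero] using hL ((v, 0), 0))
  obtain ⟨A₁, hA₁, hA₁', hA₁L⟩ := hP₁.exists_weights hθ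
    (L.comp ((LinearMap.inl ℝ _ _).comp (LinearMap.inr ℝ _ _))) (fun v => by
      simpa [hullGauge_zero] using hL ((0, v), 0))
  obtain ⟨B₀, hB₀, hB₀', hB₀L⟩ := hQ₀.exists_weights h1θ
    (L.comp ((LinearMap.inr ℝ _ _).comp (LinearMap.inl ℝ _ _))) (fun v => by
      simpa [hullGauge_zero] using hL (0, (v, 0)))
  obtain ⟨B₁, hB₁, hB₁', hB₁L⟩ := hQ₁.exists_weights hθ
    (L.comp ((LinearMap.inr ℝ _ _).comp (LinearMap.inr ℝ _ _))) (fun v => by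
      simpa [hullGauge_zero] using hL (0, (0, v)))
  refine ⟨A₀, A₁, B₀, B₁, ⟨hA₀, hA₀'⟩, ⟨hA₁, hA₁'⟩, ⟨hB₀, hB₀'⟩, ⟨hB₁, hB₁'⟩, ?_⟩
  intro φ ψ p₀ p₁ q₀ q₁ hφ hψ
  have h1 := hs ⟨((φ, ψ), ((p₀, p₁), (q₀, q₁))), hφ, hψ⟩
  rw [div_le_iff₀' (by positivity)] at h1
  refine h1.trans (mul_le_mul_of_nonneg_left (le_of_eq ?_) (by positivity))
  have hdec : ((p₀, p₁), (q₀, q₁)) =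
      ((p₀, 0), 0) + ((0, p₁), 0) + ((0, (q₀, 0)) + (0, (0, q₁))) := by simp
  change L ((p₀, p₁), (q₀, q₁)) = _
  rw [hdec, map_add, map_add, map_add]
  have e1 := hA₀L p₀
  have e2 := hA₁L p₁
  have e3 := hB₀L q₀
  have e4 := hB₁L q₁
  simp only [LinearMap.comp_apply, LinearMap.inl_apply, LinearMap.inr_apply] at e1 e2 e3 e4
  rw [e1, e2, e3, e4]

end Factorization

section Factorization

variable {ι κ : Type*} [Fintype ι] [Fintype κ] {θ : ℝ}

theorem GoodSet.exists_pos_weights {M : ℝ} {P : Set (ι → ℝ)} (hP : GoodSet M P) {A : ι → ℝ}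
    (hA : ∀ i, 0 ≤ A i) (hAP : ∀ p ∈ P, ∑ i, A i * p i ≤ 1) :
    ∃ A' : ι → ℝ, (∀ i, 0 < A' i) ∧ (∀ i, A i ≤ A' i) ∧ ∀ p ∈ P, ∑ i, A' i * p i ≤ 2 := by
  obtain ⟨b, hb⟩ := hP.bdd
  have hδ : 0 < (1 + Fintype.card ι * |b|)⁻¹ := by positivity
  refine ⟨fun i => A i + (1 + Fintype.card ι * |b|)⁻¹, fun i => by linarith [hA i],
    fun i => by linarith, fun p hp => ?_⟩
  simp_rw [add_mul, Finset.sum_add_distrib, ← Finset.mul_sum]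
  have h1 : ∑ i, p i ≤ 1 + Fintype.card ι * |b| := by
    have : ∑ i, p i ≤ ∑ _i : ι, |b| :=
      Finset.sum_le_sum fun i _ => (hb p hp i).trans (le_abs_self b)
    simp at this
    linarith
  have h2 := mul_le_mul_of_nonneg_left h1 hδ.le
  rw [inv_mul_cancel₀ (by positivity)] at h2
  linarith [hAP p hp]

theorem exists_ratios_of_weights (hθ : 0 < θ) (hθ1 : θ < 1) {M : ℝ} {P₀ P₁ : Set (ι → ℝ)}
    (hP₀ : GoodSet M P₀) (hP₁ : GoodSet M P₁) {A₀ A₁ : ι → ℝ}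
    (hA₀ : (∀ i, 0 ≤ A₀ i) ∧ ∀ p ∈ P₀, ∑ i, A₀ i * p i ≤ 1)
    (hA₁ : (∀ i, 0 ≤ A₁ i) ∧ ∀ p ∈ P₁, ∑ i, A₁ i * p i ≤ 1) :
    ∃ r : ι → ℝ, (∀ i, 0 < r i) ∧ ∀ φ : ι → ℂ,
      ((fun i => (‖φ i‖ * r i ^ θ) ^ 2) ∈ P₀ ∨ (fun i => (‖φ i‖ * r i ^ (θ - 1)) ^ 2) ∈ P₁) →
      ∃ p₀ p₁ : ι → ℝ,
        (∀ i, 0 ≤ p₀ i ∧ 0 ≤ p₁ i ∧ ‖φ i‖ ^ 2 ≤ p₀ i ^ (1 - θ) * p₁ i ^ θ) ∧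
        (1 - θ) * (∑ i, A₀ i * p₀ i) + θ * (∑ i, A₁ i * p₁ i) ≤ 2 := by
  have h1θ : 0 < 1 - θ := by linarith
  obtain ⟨A₀', hpos₀, hle₀, hA₀'⟩ := hP₀.exists_pos_weights hA₀.1 hA₀.2
  obtain ⟨A₁', hpos₁, hle₁, hA₁'⟩ := hP₁.exists_pos_weights hA₁.1 hA₁.2
  have hr : ∀ i, 0 < √(A₁' i / A₀' i) := fun i =>
    Real.sqrt_pos.2 (div_pos (hpos₁ i) (hpos₀ i))
  refine ⟨fun i => √(A₁' i / A₀' i), hr, fun φ hφ => ?_⟩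
  set r : ι → ℝ := fun i => √(A₁' i / A₀' i) with hrdef
  refine ⟨fun i => (‖φ i‖ * r i ^ θ) ^ 2, fun i => (‖φ i‖ * r i ^ (θ - 1)) ^ 2,
    fun i => ⟨by positivity, by positivity, le_of_eq ?_⟩, ?_⟩
  · have hri := hr i
    have n := norm_nonneg (φ i)
    have e : (r i ^ θ) ^ (1 - θ) * (r i ^ (θ - 1)) ^ θ = 1 := by
      rw [← Real.rpow_mul hri.le, ← Real.rpow_mul hri.le, ← Real.rpow_add hri,
        show θ * (1 - θ) + (θ - 1) * θ = 0 by ring, Real.rpow_zero]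
    have e' : ‖φ i‖ ^ (1 - θ) * ‖φ i‖ ^ θ = ‖φ i‖ := by
      rw [← Real.rpow_add' n (by norm_num)]; simp
    have hsq : ∀ (a s : ℝ), 0 ≤ a → (a ^ 2) ^ s = (a ^ s) ^ 2 := fun a s ha => by
      rw [← Real.rpow_natCast_mul ha, ← Real.rpow_mul_natCast ha, mul_comm]
    have q0 : 0 ≤ r i ^ θ := (Real.rpow_pos_of_pos hri _).le
    have q1 : 0 ≤ r i ^ (θ - 1) := (Real.rpow_pos_of_pos hri _).le
    rw [hsq _ _ (mul_nonneg n q0), hsq _ _ (mul_nonneg n q1), Real.mul_rpow n q0,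
      Real.mul_rpow n q1, ← mul_pow]
    congr 1
    calc ‖φ i‖ = (‖φ i‖ ^ (1 - θ) * ‖φ i‖ ^ θ) * ((r i ^ θ) ^ (1 - θ) * (r i ^ (θ - 1)) ^ θ) := by
          rw [e, e', mul_one]
      _ = _ := by ring
  · have hbal : ∀ i, A₁' i * (‖φ i‖ * r i ^ (θ - 1)) ^ 2 = A₀' i * (‖φ i‖ * r i ^ θ) ^ 2 := by
      intro i
      have h1 : A₁' i = A₀' i * r i ^ 2 := by
        rw [hrdef, Real.sq_sqrt (div_pos (hpos₁ i) (hpos₀ i)).le]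
        field_simp [(hpos₀ i).ne']
      have h2 : r i ^ θ = r i * r i ^ (θ - 1) := by
        have hri : 0 < r i := hr i
        rw [Real.rpow_sub hri, Real.rpow_one]
        field_simp
      rw [h1, h2]; ring
    have h₀ : ∑ i, A₀ i * (‖φ i‖ * r i ^ θ) ^ 2 ≤ ∑ i, A₀' i * (‖φ i‖ * r i ^ θ) ^ 2 :=
      Finset.sum_le_sum fun i _ => mul_le_mul_of_nonneg_right (hle₀ i) (by positivity)
    have h₁ : ∑ i, A₁ i * (‖φ i‖ * r i ^ (θ - 1)) ^ 2 ≤ ∑ i, A₀' i * (‖φ i‖ * r i ^ θ) ^ 2 :=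
      (Finset.sum_le_sum fun i _ => mul_le_mul_of_nonneg_right (hle₁ i) (by positivity)).trans
        (le_of_eq (Finset.sum_congr rfl fun i _ => hbal i))
    have h2 : ∑ i, A₀' i * (‖φ i‖ * r i ^ θ) ^ 2 ≤ 2 := by
      rcases hφ with h | h
      · exact hA₀' _ h
      · rw [← Finset.sum_congr rfl fun i _ => hbal i]
        exact hA₁' _ h
    nlinarith

theorem exists_ratios_of_matForm (hθ : 0 < θ) (hθ1 : θ < 1) {M I : ℝ} (hM : 0 < M) (hI : 0 < I)
    {P₀ P₁ : Set (ι → ℝ)} {Q₀ Q₁ : Set (κ → ℝ)} (hP₀ : GoodSet M P₀) (hP₁ : GoodSet M P₁)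
    (hQ₀ : GoodSet M Q₀) (hQ₁ : GoodSet M Q₁) (z : ι → κ → ℂ)
    (hz : ∀ φ ∈ calderonBall θ P₀ P₁, ∀ ψ ∈ calderonBall θ Q₀ Q₁, ‖matForm z φ ψ‖ ≤ I) :
    ∃ (r : ι → ℝ) (t : κ → ℝ), (∀ i, 0 < r i) ∧ (∀ j, 0 < t j) ∧
      ∀ (φ : ι → ℂ) (ψ : κ → ℂ),
        ((fun i => (‖φ i‖ * r i ^ θ) ^ 2) ∈ P₀ ∨
          (fun i => (‖φ i‖ * r i ^ (θ - 1)) ^ 2) ∈ P₁) →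
        ((fun j => (‖ψ j‖ * t j ^ θ) ^ 2) ∈ Q₀ ∨
          (fun j => (‖ψ j‖ * t j ^ (θ - 1)) ^ 2) ∈ Q₁) →
        ‖matForm z φ ψ‖ ≤ 432 * (M * I) := by
  obtain ⟨A₀, A₁, B₀, B₁, hA₀, hA₁, hB₀, hB₁, H⟩ :=
    exists_weights_of_matForm hθ hθ1 hM hI hP₀ hP₁ hQ₀ hQ₁ z hz
  obtain ⟨r, hr, hrφ⟩ := exists_ratios_of_weights hθ hθ1 hP₀ hP₁ hA₀ hA₁
  obtain ⟨t, ht, htψ⟩ := exists_ratios_of_weights hθ hθ1 hQ₀ hQ₁ hB₀ hB₁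
  refine ⟨r, t, hr, ht, fun φ ψ hφ hψ => ?_⟩
  obtain ⟨p₀, p₁, hp, hp2⟩ := hrφ φ hφ
  obtain ⟨q₀, q₁, hq, hq2⟩ := htψ ψ hψ
  by_cases h0 : matForm z φ ψ = 0
  · rw [h0, norm_zero]; positivity
  have hn : ‖matForm z φ ψ‖ ≠ 0 := norm_ne_zero_iff.2 h0
  set u : ℂ := (starRingEnd ℂ) (matForm z φ ψ) / ‖matForm z φ ψ‖ with hu
  have hu1 : ‖u‖ = 1 := by simp [hu, hn]
  have h1 : matForm z (u • φ) ψ = (‖matForm z φ ψ‖ : ℂ) := by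
    rw [matForm_smul_left, hu, div_mul_eq_mul_div, Complex.conj_mul', sq]
    field_simp
  have h2 := H (u • φ) ψ p₀ p₁ q₀ q₁ (fun i => by
    simpa [hu1] using hp i) hq
  rw [h1, Complex.ofReal_re] at h2
  refine h2.trans ?_
  rw [show 432 * (M * I) = 108 * (M * I) * (2 + 2) by ring]
  exact mul_le_mul_of_nonneg_left (add_le_add hp2 hq2) (by positivity)

end Factorization

section Lattice

variable {D : Type*} [AddCommGroup D] [Module ℂ D] {ι : Type*}

open Classical in
/-- The image of the `i`-th unit vector. -/
def atomVec (J : (ι → ℂ) →ₗ[ℂ] D) (i : ι) : D := J (Pi.single i 1)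

theorem sum_smul_atomVec [Fintype ι] (J : (ι → ℂ) →ₗ[ℂ] D) (x : ι → ℂ) :
    ∑ i, x i • atomVec J i = J x := by
  classical
  rw [LinearMap.pi_apply_eq_sum_univ J x]
  refine Finset.sum_congr rfl fun i _ => congrArg _ (congrArg J ?_)
  ext j
  simp [Pi.single_apply, eq_comm]

/-- `J` represents `ℂ^ι` as a sublattice on which the seminorm `N` is monotone, `2`-concave with
constant `M` and does not vanish on the unit vectors. -/
structure LatticeRep (N : Seminorm ℂ D) (M : ℝ) (J : (ι → ℂ) →ₗ[ℂ] D) : Prop where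
  mono : ∀ x y : ι → ℂ, (∀ i, ‖x i‖ ≤ ‖y i‖) → N (J x) ≤ N (J y)
  concave : ∀ (n : ℕ) (x : Fin n → ι → ℂ), ∑ k, N (J (x k)) ^ 2 ≤
    M ^ 2 * N (J fun i => ((√(∑ k, ‖x k i‖ ^ 2) : ℝ) : ℂ)) ^ 2
  pos : ∀ i, 0 < N (atomVec J i)

/-- The squares of the nonnegative functionals dominated by `N ∘ J`. -/
def dualSquares [Fintype ι] (N : Seminorm ℂ D) (J : (ι → ℂ) →ₗ[ℂ] D) : Set (ι → ℝ) :=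
  {p | (∀ i, 0 ≤ p i) ∧ ∀ x : ι → ℂ, ∑ i, √(p i) * ‖x i‖ ≤ N (J x)}

variable {N : Seminorm ℂ D} {M : ℝ} {J : (ι → ℂ) →ₗ[ℂ] D}

theorem LatticeRep.concave' (hJ : LatticeRep N M J) {K : Type*} [Fintype K] (x : K → ι → ℂ) :
    ∑ k, N (J (x k)) ^ 2 ≤ M ^ 2 * N (J fun i => ((√(∑ k, ‖x k i‖ ^ 2) : ℝ) : ℂ)) ^ 2 := by
  have e := (Fintype.equivFin K).symm
  have h := hJ.concave _ fun k => x (e k)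
  rw [e.sum_comp fun k => N (J (x k)) ^ 2] at h
  have he : ∀ i, ∑ k, ‖x (e k) i‖ ^ 2 = ∑ k, ‖x k i‖ ^ 2 := fun i =>
    e.sum_comp fun k => ‖x k i‖ ^ 2
  simp_rw [he] at h
  exact h

theorem LatticeRep.norm_mul_le (hJ : LatticeRep N M J) (x : ι → ℂ) (i : ι) :
    ‖x i‖ * N (atomVec J i) ≤ N (J x) := by
  rw [← map_smul_eq_mul, atomVec, ← map_smul]
  refine hJ.mono _ _ fun j => ?_
  by_cases h : j = i
  · subst h; simp
  · simp [h]

theorem LatticeRep.goodSet [Fintype ι] (hJ : LatticeRep N M J) (hM : 0 < M) :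
    GoodSet (M ^ 2) (dualSquares N J) := by
  classical
  refine ⟨fun p hp => hp.1, ⟨∑ i, N (atomVec J i) ^ 2, fun p hp i => ?_⟩, ?_, ?_⟩
  · have h1 := hp.2 (Pi.single i 1)
    rw [Finset.sum_eq_single i (fun j _ hj => by simp [hj]) (by simp)] at h1
    simp only [Pi.single_eq_same, norm_one, mul_one] at h1
    change _ ≤ N (atomVec J i) at h1
    have h2 : p i ≤ N (atomVec J i) ^ 2 := by
      rw [← Real.sq_sqrt (hp.1 i)]; gcongr
    exact h2.trans (Finset.single_le_sum (f := fun i => N (atomVec J i) ^ 2)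
      (fun i _ => by positivity) (Finset.mem_univ i))
  · have hpos := hJ.pos
    have hc : (0 : ℝ) < Fintype.card ι + 1 := by positivity
    refine ⟨fun i => (N (atomVec J i) / (Fintype.card ι + 1)) ^ 2,
      ⟨fun i => by positivity, fun x => ?_⟩, fun i => by have := hpos i; positivity⟩
    have h1 : ∀ i, √((N (atomVec J i) / (Fintype.card ι + 1)) ^ 2) * ‖x i‖ ≤
        N (J x) / (Fintype.card ι + 1) := fun i => by
      rw [Real.sqrt_sq (div_nonneg (hpos i).le hc.le), div_mul_eq_mul_div, mul_comm]
      exact div_le_div_of_nonneg_right (hJ.norm_mul_le x i) hc.le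
    refine (Finset.sum_le_sum fun i _ => h1 i).trans ?_
    rw [Finset.sum_const, Finset.card_univ, nsmul_eq_mul, mul_div_assoc', div_le_iff₀ hc]
    nlinarith [apply_nonneg N (J x)]
  · intro p hp
    obtain ⟨K, _, w, q, hw, hw1, hq, rfl⟩ := mem_convexHull_iff_exists_fintype.1 hp
    set p : ι → ℝ := ∑ k, w k • q k with hpdef
    have hpi : ∀ i, p i = ∑ k, w k * q k i := fun i => by simp [hpdef]
    have hp0 : ∀ i, 0 ≤ p i := fun i => by
      rw [hpi]; exact Finset.sum_nonneg fun k _ => mul_nonneg (hw k) ((hq k).1 i)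
    refine ⟨fun i => p i / M ^ 2, ⟨fun i => div_nonneg (hp0 i) (by positivity), fun x => ?_⟩,
      fun i => by field_simp; exact le_rfl⟩
    have hsM : ∀ i, √(p i / M ^ 2) = √(p i) / M := fun i => by
      rw [Real.sqrt_div (hp0 i), Real.sqrt_sq hM.le]
    let f : K → ι → ℝ := fun k i => √(w k) * √(q k i) * ‖x i‖ / √(p i)
    have hf0 : ∀ k i, 0 ≤ f k i := fun k i => by positivity
    have hfsum : ∀ i, ∑ k, √(w k) * (√(q k i) * f k i) = √(p i) * ‖x i‖ := by
      intro i
      have : ∀ k, √(w k) * (√(q k i) * f k i) = w k * q k i * (‖x i‖ / √(p i)) := fun k => by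
        calc √(w k) * (√(q k i) * f k i)
            = (√(w k) * √(w k)) * (√(q k i) * √(q k i)) * (‖x i‖ / √(p i)) := by
              simp only [f]; ring
          _ = _ := by rw [Real.mul_self_sqrt (hw k), Real.mul_self_sqrt ((hq k).1 i)]
      simp_rw [this, ← Finset.sum_mul, ← hpi]
      rw [mul_div_left_comm, Real.div_sqrt, mul_comm]
    have hfsq : ∀ i, √(∑ k, ‖(f k i : ℂ)‖ ^ 2) ≤ ‖x i‖ := by
      intro i
      have : ∀ k, ‖(f k i : ℂ)‖ ^ 2 = w k * q k i * (‖x i‖ ^ 2 / p i) := fun k => by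
        rw [Complex.norm_real, Real.norm_of_nonneg (hf0 k i)]
        simp only [f]
        rw [div_pow, mul_pow, mul_pow, Real.sq_sqrt (hw k), Real.sq_sqrt ((hq k).1 i),
          Real.sq_sqrt (hp0 i)]
        ring
      simp_rw [this, ← Finset.sum_mul, ← hpi]
      rw [Real.sqrt_le_left (norm_nonneg _)]
      rcases (hp0 i).eq_or_lt with h | h
      · rw [← h]; simp
      · rw [mul_div_cancel₀ _ h.ne']
    have hNf : ∑ k, N (J fun i => (f k i : ℂ)) ^ 2 ≤ (M * N (J x)) ^ 2 := by
      refine (hJ.concave' _).trans ?_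
      rw [mul_pow]
      gcongr
      refine hJ.mono _ _ fun i => ?_
      rw [Complex.norm_real, Real.norm_of_nonneg (Real.sqrt_nonneg _)]
      exact hfsq i
    have hmain : ∑ i, √(p i) * ‖x i‖ ≤ M * N (J x) := by
      calc ∑ i, √(p i) * ‖x i‖ = ∑ k, √(w k) * ∑ i, √(q k i) * f k i := by
            simp_rw [← hfsum, Finset.mul_sum]
            exact Finset.sum_comm
        _ ≤ ∑ k, √(w k) * N (J fun i => (f k i : ℂ)) := by
            refine Finset.sum_le_sum fun k _ => mul_le_mul_of_nonneg_left ?_ (Real.sqrt_nonneg _)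
            refine le_trans (le_of_eq ?_) ((hq k).2 fun i => (f k i : ℂ))
            exact Finset.sum_congr rfl fun i _ => by
              rw [Complex.norm_real, Real.norm_of_nonneg (hf0 k i)]
        _ ≤ √(∑ k, √(w k) ^ 2) * √(∑ k, N (J fun i => (f k i : ℂ)) ^ 2) :=
            Real.sum_mul_le_sqrt_mul_sqrt _ _ _
        _ ≤ 1 * (M * N (J x)) := by
            gcongr
            · simp_rw [Real.sq_sqrt (hw _), hw1]; simp
            · exact Real.sqrt_le_iff.2 ⟨mul_nonneg hM.le (apply_nonneg _ _), hNf⟩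
        _ = _ := one_mul _
    simp_rw [hsM, div_mul_eq_mul_div, ← Finset.sum_div]
    rwa [div_le_iff₀' hM]

end Lattice

section Duality

variable {D : Type*} [AddCommGroup D] [Module ℂ D] {ι : Type*} [Fintype ι] {θ M : ℝ}
  {N₀ N₁ : Seminorm ℂ D} {J : (ι → ℂ) →ₗ[ℂ] D}

theorem norm_sum_le_interpN (hθ : 0 < θ) (hθ1 : θ < 1) {φ : ι → ℂ}
    (hφ : φ ∈ calderonBall θ (dualSquares N₀ J) (dualSquares N₁ J)) (x : ι → ℂ) :
    ‖∑ i, φ i * x i‖ ≤ interpN θ (N₀.comp J) (N₁.comp J) x := by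
  obtain ⟨p₀, hp₀, p₁, hp₁, hp⟩ := hφ
  have hle : ∀ i, ‖φ i‖ ≤ √(p₀ i) ^ (1 - θ) * √(p₁ i) ^ θ := fun i => by
    have h1 : ∀ (a s : ℝ), 0 ≤ a → √a ^ s = √(a ^ s) := fun a s ha => by
      rw [Real.sqrt_eq_rpow, Real.sqrt_eq_rpow, ← Real.rpow_mul ha, ← Real.rpow_mul ha, mul_comm]
    rw [h1 _ _ (hp₀.1 i), h1 _ _ (hp₁.1 i), ← Real.sqrt_mul (Real.rpow_nonneg (hp₀.1 i) _)]
    exact Real.le_sqrt_of_sq_le (hp i)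
  choose r hr hr₀ hr₁ using fun i => exists_ratio hθ hθ1 (Real.sqrt_nonneg (p₀ i))
    (Real.sqrt_nonneg (p₁ i)) (hle i)
  refine le_of_forall_pos_le_add fun ε hε => ?_
  obtain ⟨m, h, v, hh, hx, h0, h1⟩ := exists_of_interpN_lt
    (show interpN θ (N₀.comp J) (N₁.comp J) x < interpN θ (N₀.comp J) (N₁.comp J) x + ε by linarith)
  have hG : StripFun fun z => ∑ i, φ i * (r i : ℂ) ^ (z - θ) * ∑ l, h l z * v l i :=
    StripFun.sum _ fun i => ((StripFun.const _).mul (StripFun.cpow (hr i) θ)).mul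
      (StripFun.sum _ fun l => (hh l).mul (StripFun.const _))
  have key := hG.norm_le hθ hθ1 (c := interpN θ (N₀.comp J) (N₁.comp J) x + ε) (fun t => ?_)
    (fun t => ?_)
  · simpa [← hx] using key
  · refine le_trans ?_ ((hp₀.2 _).trans (h0 t))
    refine (norm_sum_le _ _).trans (Finset.sum_le_sum fun i _ => ?_)
    rw [norm_mul, norm_mul, norm_cpow_left (hr i)]
    refine mul_le_mul (hr₀ i) (le_of_eq ?_) (norm_nonneg _) (Real.sqrt_nonneg _)
    simp
  · refine le_trans ?_ ((hp₁.2 _).trans (h1 t))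
    refine (norm_sum_le _ _).trans (Finset.sum_le_sum fun i _ => ?_)
    rw [norm_mul, norm_mul, norm_cpow_right (hr i)]
    refine mul_le_mul (hr₁ i) (le_of_eq ?_) (norm_nonneg _) (Real.sqrt_nonneg _)
    simp

theorem sum_norm_mul_rpow_le_one (hθ : 0 < θ) (hθ1 : θ < 1) (h₀ : LatticeRep N₀ M J)
    (h₁ : LatticeRep N₁ M J) {φ : D →ₗ[ℂ] ℂ} (hφ : ∀ x, ‖φ x‖ ≤ interpN θ N₀ N₁ x)
    {g h : ι → ℝ} (hg : ∀ i, 0 ≤ g i) (hh : ∀ i, 0 ≤ h i) (hg1 : N₀ (J fun i => (g i : ℂ)) ≤ 1)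
    (hh1 : N₁ (J fun i => (h i : ℂ)) ≤ 1) :
    ∑ i, ‖φ (atomVec J i)‖ * (g i ^ (1 - θ) * h i ^ θ) ≤ 1 := by
  choose r hr hr₀ hr₁ using fun i => exists_ratio hθ hθ1 (hg i) (hh i) le_rfl
  have hu : ∀ i, ∃ u : ℂ, ‖u‖ = 1 ∧ u * φ (atomVec J i) = ‖φ (atomVec J i)‖ := fun i => by
    by_cases h0 : φ (atomVec J i) = 0
    · exact ⟨1, by simp, by simp [h0]⟩
    · have hn : ‖φ (atomVec J i)‖ ≠ 0 := norm_ne_zero_iff.2 h0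
      refine ⟨(starRingEnd ℂ) (φ (atomVec J i)) / ‖φ (atomVec J i)‖, by simp [hn], ?_⟩
      rw [div_mul_eq_mul_div, Complex.conj_mul', sq]
      field_simp
  choose u hu1 hu using hu
  have hx0 : ∀ i, 0 ≤ g i ^ (1 - θ) * h i ^ θ := fun i =>
    mul_nonneg (Real.rpow_nonneg (hg i) _) (Real.rpow_nonneg (hh i) _)
  have key : interpN θ N₀ N₁
      (∑ i, (u i * ((g i ^ (1 - θ) * h i ^ θ : ℝ) : ℂ)) • atomVec J i) ≤ 1 := by
    refine interpN_le (apply_nonneg N₀)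
      (fun i z => u i * ((g i ^ (1 - θ) * h i ^ θ : ℝ) : ℂ) * (r i : ℂ) ^ (z - θ)) (atomVec J)
      (fun i => (StripFun.const _).mul (StripFun.cpow (hr i) θ)) (by simp) (fun t => ?_)
      (fun t => ?_)
    · rw [sum_smul_atomVec J fun i =>
        u i * ((g i ^ (1 - θ) * h i ^ θ : ℝ) : ℂ) * (r i : ℂ) ^ (Complex.I * t - θ)]
      refine (h₀.mono _ _ fun i => ?_).trans hg1
      rw [norm_mul, norm_mul, norm_cpow_left (hr i), hu1, one_mul, Complex.norm_real,
        Complex.norm_real, Real.norm_of_nonneg (hx0 i), Real.norm_of_nonneg (hg i)]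
      exact hr₀ i
    · rw [sum_smul_atomVec J fun i =>
        u i * ((g i ^ (1 - θ) * h i ^ θ : ℝ) : ℂ) * (r i : ℂ) ^ (1 + Complex.I * t - θ)]
      refine (h₁.mono _ _ fun i => ?_).trans hh1
      rw [norm_mul, norm_mul, norm_cpow_right (hr i), hu1, one_mul, Complex.norm_real,
        Complex.norm_real, Real.norm_of_nonneg (hx0 i), Real.norm_of_nonneg (hh i)]
      exact hr₁ i
  have h2 := (hφ _).trans key
  rw [map_sum] at h2
  have h3 : ∑ i, φ ((u i * ((g i ^ (1 - θ) * h i ^ θ : ℝ) : ℂ)) • atomVec J i) =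
      ((∑ i, ‖φ (atomVec J i)‖ * (g i ^ (1 - θ) * h i ^ θ) : ℝ) : ℂ) := by
    rw [Complex.ofReal_sum]
    refine Finset.sum_congr rfl fun i _ => ?_
    rw [map_smul, smul_eq_mul, mul_right_comm, hu, Complex.ofReal_mul, Complex.ofReal_mul,
      Complex.ofReal_mul]
  rw [h3, Complex.norm_real] at h2
  exact (le_abs_self _).trans h2

theorem sum_norm_mul_rpow_le (hθ : 0 < θ) (hθ1 : θ < 1) (h₀ : LatticeRep N₀ M J)
    (h₁ : LatticeRep N₁ M J) {φ : D →ₗ[ℂ] ℂ} (hφ : ∀ x, ‖φ x‖ ≤ interpN θ N₀ N₁ x)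
    {g h : ι → ℝ} (hg : ∀ i, 0 ≤ g i) (hh : ∀ i, 0 ≤ h i) :
    ∑ i, ‖φ (atomVec J i)‖ * (g i ^ (1 - θ) * h i ^ θ) ≤
      (1 - θ) * N₀ (J fun i => (g i : ℂ)) + θ * N₁ (J fun i => (h i : ℂ)) := by
  have h1θ : 0 < 1 - θ := by linarith
  refine le_of_forall_pos_le_add fun ε hε => ?_
  set a := N₀ (J fun i => (g i : ℂ)) + ε with ha
  set b := N₁ (J fun i => (h i : ℂ)) + ε with hb
  have ha0 : 0 < a := by have := apply_nonneg N₀ (J fun i => (g i : ℂ)); linarith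
  have hb0 : 0 < b := by have := apply_nonneg N₁ (J fun i => (h i : ℂ)); linarith
  have scale : ∀ (N : Seminorm ℂ D) (c : ℝ) (g : ι → ℝ), 0 < c →
      N (J fun i => ((c⁻¹ * g i : ℝ) : ℂ)) = c⁻¹ * N (J fun i => (g i : ℂ)) := by
    intro N c g hc
    have : (fun i => ((c⁻¹ * g i : ℝ) : ℂ)) = (c⁻¹ : ℂ) • fun i => (g i : ℂ) := by
      ext i; simp
    rw [this, map_smul, map_smul_eq_mul, norm_inv, Complex.norm_real, Real.norm_of_nonneg hc.le]
  have key := sum_norm_mul_rpow_le_one hθ hθ1 h₀ h₁ hφ (g := fun i => a⁻¹ * g i)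
    (h := fun i => b⁻¹ * h i) (fun i => mul_nonneg (inv_pos.2 ha0).le (hg i))
    (fun i => mul_nonneg (inv_pos.2 hb0).le (hh i))
    (by rw [scale _ _ _ ha0, inv_mul_le_iff₀ ha0]; linarith)
    (by rw [scale _ _ _ hb0, inv_mul_le_iff₀ hb0]; linarith)
  have e : ∀ i, ‖φ (atomVec J i)‖ * ((a⁻¹ * g i) ^ (1 - θ) * (b⁻¹ * h i) ^ θ) =
      (a ^ (1 - θ) * b ^ θ)⁻¹ * (‖φ (atomVec J i)‖ * (g i ^ (1 - θ) * h i ^ θ)) := fun i => by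
    rw [Real.mul_rpow (inv_pos.2 ha0).le (hg i), Real.mul_rpow (inv_pos.2 hb0).le (hh i),
      Real.inv_rpow ha0.le, Real.inv_rpow hb0.le, mul_inv]
    ring
  simp_rw [e, ← Finset.mul_sum] at key
  rw [inv_mul_le_iff₀ (by positivity), mul_one] at key
  refine key.trans ((Real.geom_mean_le_arith_mean2_weighted h1θ.le hθ.le ha0.le hb0.le
    (by ring)).trans (le_of_eq ?_))
  rw [ha, hb]; ring

theorem LatticeRep.exists_abs_weights {N : Seminorm ℂ D} (hJ : LatticeRep N M J) {w : ℝ}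
    (hw : 0 < w) (L : (ι → ℝ) →ₗ[ℝ] ℝ) (hL : ∀ g, L g ≤ w * N (J fun i => (g i : ℂ))) :
    ∃ a : ι → ℝ, (∀ i, 0 ≤ a i) ∧ (∀ x : ι → ℂ, ∑ i, a i * ‖x i‖ ≤ N (J x)) ∧
      ∀ g : ι → ℝ, (∀ i, 0 ≤ g i) → L g ≤ w * ∑ i, a i * g i := by
  classical
  have hLg : ∀ g, L g = ∑ i, g i * L (Pi.single i 1) := fun g => by
    rw [LinearMap.pi_apply_eq_sum_univ L g]
    refine Finset.sum_congr rfl fun i _ => ?_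
    have : (fun j => if i = j then (1 : ℝ) else 0) = Pi.single i 1 := by
      ext j; simp [Pi.single_apply, eq_comm]
    rw [this, smul_eq_mul]
  refine ⟨fun i => w⁻¹ * |L (Pi.single i 1)|, fun i => by positivity, fun x => ?_, fun g hg => ?_⟩
  · have h1 := hL fun i => ‖x i‖ * SignType.sign (L (Pi.single i 1))
    rw [hLg] at h1
    have h2 : N (J fun i => ((‖x i‖ * SignType.sign (L (Pi.single i 1)) : ℝ) : ℂ)) ≤ N (J x) := by
      refine hJ.mono _ _ fun i => ?_
      rw [Complex.norm_real, norm_mul, norm_norm]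
      refine mul_le_of_le_one_right (norm_nonneg _) ?_
      rcases SignType.trichotomy (SignType.sign (L (Pi.single i 1))) with h | h | h <;> simp [h]
    have h3 : ∀ i, ‖x i‖ * (SignType.sign (L (Pi.single i 1)) : ℝ) * L (Pi.single i 1) =
        |L (Pi.single i 1)| * ‖x i‖ := fun i => by
      rw [mul_assoc, sign_mul_self, mul_comm]
    simp_rw [h3] at h1
    simp_rw [mul_assoc, ← Finset.mul_sum]
    rw [inv_mul_le_iff₀ hw]
    exact h1.trans (mul_le_mul_of_nonneg_left h2 hw.le)
  · simp_rw [mul_assoc, ← Finset.mul_sum]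
    rw [mul_inv_cancel_left₀ hw.ne', hLg]
    exact Finset.sum_le_sum fun i _ => by
      rw [mul_comm]; exact mul_le_mul_of_nonneg_right (le_abs_self _) (hg i)

/-- A functional dominated by the interpolation norm factors through the two endpoint duals. -/
theorem exists_ratios_of_functional (hθ : 0 < θ) (hθ1 : θ < 1) (h₀ : LatticeRep N₀ M J)
    (h₁ : LatticeRep N₁ M J) {φ : D →ₗ[ℂ] ℂ} (hφ : ∀ x, ‖φ x‖ ≤ interpN θ N₀ N₁ x) :
    ∃ r : ι → ℝ, (∀ i, 0 < r i) ∧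
      (∀ x : ι → ℂ, ∑ i, ‖φ (atomVec J i)‖ * r i ^ (-θ) * ‖x i‖ ≤ N₀ (J x)) ∧
      ∀ x : ι → ℂ, ∑ i, ‖φ (atomVec J i)‖ * r i ^ (1 - θ) * ‖x i‖ ≤ N₁ (J x) := by
  classical
  have h1θ : 0 < 1 - θ := by linarith
  have hadd : ∀ (N : Seminorm ℂ D) (g h : ι → ℝ), N (J fun i => ((g + h) i : ℂ)) ≤
      N (J fun i => (g i : ℂ)) + N (J fun i => (h i : ℂ)) := fun N g h => by
    have : (fun i => ((g + h) i : ℂ)) = (fun i => (g i : ℂ)) + fun i => (h i : ℂ) := by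
      ext i; simp
    rw [this, map_add]
    exact map_add_le_add N _ _
  have hsmul : ∀ (N : Seminorm ℂ D) (c : ℝ) (g : ι → ℝ), 0 < c →
      N (J fun i => ((c • g) i : ℂ)) = c * N (J fun i => (g i : ℂ)) := fun N c g hc => by
    have : (fun i => ((c • g) i : ℂ)) = (c : ℂ) • fun i => (g i : ℂ) := by
      ext i; simp
    rw [this, map_smul, map_smul_eq_mul, Complex.norm_real, Real.norm_of_nonneg hc.le]
  obtain ⟨L, hL, hs⟩ := mazur_orlicz (V := (ι → ℝ) × (ι → ℝ))
    (ι := {w : (ι → ℝ) × (ι → ℝ) // ∀ i, 0 ≤ w.1 i ∧ 0 ≤ w.2 i})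
    (fun v => (1 - θ) * N₀ (J fun i => (v.1 i : ℂ)) + θ * N₁ (J fun i => (v.2 i : ℂ)))
    (fun c hc v => by
      simp only [Prod.smul_fst, Prod.smul_snd]
      rw [hsmul _ _ _ hc, hsmul _ _ _ hc]; ring)
    (fun u v => by
      have e1 := mul_le_mul_of_nonneg_left (hadd N₀ u.1 v.1) h1θ.le
      have e2 := mul_le_mul_of_nonneg_left (hadd N₁ u.2 v.2) hθ.le
      simp only [Prod.fst_add, Prod.snd_add]
      linarith)
    (fun w => w.1) (fun w => ∑ i, ‖φ (atomVec J i)‖ * (w.1.1 i ^ (1 - θ) * w.1.2 i ^ θ))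
    (fun c hc => by
      simp only [Prod.fst_sum, Prod.snd_sum, Prod.smul_fst, Prod.smul_snd]
      refine le_trans ?_ (sum_norm_mul_rpow_le hθ hθ1 h₀ h₁ hφ (fun i => ?_) fun i => ?_)
      · simp_rw [Finset.mul_sum]
        rw [Finset.sum_comm]
        refine Finset.sum_le_sum fun i _ => ?_
        rw [Finset.sum_congr rfl fun w _ => mul_left_comm _ _ _, ← Finset.mul_sum]
        refine mul_le_mul_of_nonneg_left ?_ (norm_nonneg _)
        simpa using sum_mul_rpow_mul_rpow_le c.support hθ hθ1 c (fun w => w.1.1 i)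
          (fun w => w.1.2 i) hc (fun w => (w.2 i).1) (fun w => (w.2 i).2)
      · simpa using Finset.sum_nonneg fun w _ => mul_nonneg (hc w) (w.2 i).1
      · simpa using Finset.sum_nonneg fun w _ => mul_nonneg (hc w) (w.2 i).2)
  obtain ⟨a₀, ha₀, ha₀N, ha₀L⟩ := h₀.exists_abs_weights h1θ (L.comp (LinearMap.inl ℝ _ _))
    (fun g => by
      refine (hL (g, 0)).trans (le_of_eq ?_)
      have : (fun i => (((0 : ι → ℝ) i : ℝ) : ℂ)) = 0 := by ext; simp
      simp only [this, map_zero, mul_zero, add_zero])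
  obtain ⟨a₁, ha₁, ha₁N, ha₁L⟩ := h₁.exists_abs_weights hθ (L.comp (LinearMap.inr ℝ _ _))
    (fun g => by
      refine (hL (0, g)).trans (le_of_eq ?_)
      have : (fun i => (((0 : ι → ℝ) i : ℝ) : ℂ)) = 0 := by ext; simp
      simp only [this, map_zero, mul_zero, zero_add])
  have hle : ∀ i, ‖φ (atomVec J i)‖ ≤ a₀ i ^ (1 - θ) * a₁ i ^ θ := by
    intro i
    refine le_rpow_mul_rpow_of_forall hθ hθ1 (ha₀ i) (ha₁ i) fun s t hs' ht' => ?_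
    have hn : ∀ (s : ℝ), 0 < s → ∀ j, 0 ≤ (Pi.single i s : ι → ℝ) j := fun s hs j => by
      by_cases h : j = i
      · subst h; simpa using hs.le
      · simp [h]
    have h1 := hs ⟨(Pi.single i s, Pi.single i t), fun j => ⟨hn s hs' j, hn t ht' j⟩⟩
    have h2 := ha₀L (Pi.single i s) (hn s hs')
    have h3 := ha₁L (Pi.single i t) (hn t ht')
    have single : ∀ (a : ι → ℝ) (s : ℝ), ∑ j, a j * (Pi.single i s : ι → ℝ) j = a i * s :=
      fun a s => by
        rw [Finset.sum_eq_single i (fun j _ hj => by simp [hj]) (by simp)]; simp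
    rw [single] at h2 h3
    rw [Finset.sum_eq_single i (fun j _ hj => by simp [hj, Real.zero_rpow hθ.ne']) (by simp)] at h1
    simp only [Pi.single_eq_same] at h1
    have hdec : ((Pi.single i s, Pi.single i t) : (ι → ℝ) × (ι → ℝ)) =
        (Pi.single i s, 0) + (0, Pi.single i t) := by simp
    rw [hdec, map_add] at h1
    simp only [LinearMap.comp_apply, LinearMap.inl_apply, LinearMap.inr_apply] at h2 h3
    linarith
  choose r hr hr₀ hr₁ using fun i => exists_ratio hθ hθ1 (ha₀ i) (ha₁ i) (hle i)
  exact ⟨r, hr, fun x => (Finset.sum_le_sum fun i _ =>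
    mul_le_mul_of_nonneg_right (hr₀ i) (norm_nonneg _)).trans (ha₀N x), fun x =>
    (Finset.sum_le_sum fun i _ => mul_le_mul_of_nonneg_right (hr₁ i) (norm_nonneg _)).trans
      (ha₁N x)⟩

end Duality

section Approximation

variable {D : Type*} [AddCommGroup D] [Module ℂ D] {N₀ N₁ : Seminorm ℂ D} {M θ : ℝ}

/-- Finitely many vectors always lie, up to null vectors of `N₀` and `N₁`, in a
finite-dimensional sublattice represented by some `ℂ^ι`. -/
def Approximable (N₀ N₁ : Seminorm ℂ D) (M : ℝ) : Prop :=
  ∀ (m : ℕ) (f : Fin m → D), ∃ (ι : Type) (_ : Fintype ι) (J : (ι → ℂ) →ₗ[ℂ] D)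
    (a : Fin m → ι → ℂ), LatticeRep N₀ M J ∧ LatticeRep N₁ M J ∧
      ∀ k, N₀ (f k - J (a k)) = 0 ∧ N₁ (f k - J (a k)) = 0

theorem Approximable.exists_rep (h : Approximable N₀ N₁ M) {K : Type*} [Fintype K] (f : K → D) :
    ∃ (ι : Type) (_ : Fintype ι) (J : (ι → ℂ) →ₗ[ℂ] D) (a : K → ι → ℂ),
      LatticeRep N₀ M J ∧ LatticeRep N₁ M J ∧
        ∀ k, N₀ (f k - J (a k)) = 0 ∧ N₁ (f k - J (a k)) = 0 := by
  have e := Fintype.equivFin K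
  obtain ⟨ι, hι, J, a, h₀, h₁, ha⟩ := h _ (f ∘ e.symm)
  exact ⟨ι, hι, J, a ∘ e, h₀, h₁, fun k => by simpa using ha (e k)⟩

theorem eq_of_dominated {N : D → ℝ} {φ : D →ₗ[ℂ] ℂ} (hφ : ∀ x, ‖φ x‖ ≤ N x) {x y : D}
    (h : N (x - y) = 0) : φ x = φ y := by
  have := hφ (x - y)
  rw [h, norm_le_zero_iff, map_sub, sub_eq_zero] at this
  exact this

theorem interpN_eq_zero {x : D} (h₀ : N₀ x = 0) (h₁ : N₁ x = 0) : interpN θ N₀ N₁ x = 0 :=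
  le_antisymm ((interpN_le_max (apply_nonneg N₀) x).trans (by simp [h₀, h₁]))
    (interpN_nonneg (apply_nonneg N₀) x)

theorem exists_dominated_of_sum_le {ι : Type*} [Fintype ι] (N : Seminorm ℂ D)
    (J : (ι → ℂ) →ₗ[ℂ] D) (c : ι → ℂ) (h : ∀ x : ι → ℂ, ∑ i, ‖c i‖ * ‖x i‖ ≤ N (J x)) :
    ∃ Φ : D →ₗ[ℂ] ℂ, (∀ x, ‖Φ x‖ ≤ N x) ∧ ∀ x, Φ (J x) = ∑ i, c i * x i := by
  obtain ⟨Φ, hΦ, hJ⟩ := exists_dominated_extension N (0 : Seminorm ℂ (ι → ℂ)) J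
    (∑ i, c i • LinearMap.proj i) (fun x => by
      simp only [LinearMap.sum_apply, LinearMap.smul_apply, LinearMap.proj_apply, smul_eq_mul]
      refine ((norm_sum_le _ _).trans ?_).trans (le_add_of_nonneg_right (apply_nonneg _ _))
      simpa using h x)
  refine ⟨Φ, hΦ, fun x => ?_⟩
  have := hJ x
  rw [_root_.zero_apply, norm_le_zero_iff, sub_eq_zero] at this
  simpa using this.symm

theorem apply_map_eq_sum {ι : Type*} [Fintype ι] (J : (ι → ℂ) →ₗ[ℂ] D) (φ : D →ₗ[ℂ] ℂ)
    (x : ι → ℂ) : φ (J x) = ∑ i, φ (atomVec J i) * x i := by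
  rw [← sum_smul_atomVec J x, map_sum]
  simp [mul_comm]

end Approximation

section EasyInequality

variable {D D' : Type*} [AddCommGroup D] [Module ℂ D] [AddCommGroup D'] [Module ℂ D']
  {N₀ N₁ : Seminorm ℂ D} {N₀' N₁' : Seminorm ℂ D'} {M θ : ℝ}

open TensorProduct in
theorem exists_eq_sum_tmul (z : D ⊗[ℂ] D') :
    ∃ (m : ℕ) (f : Fin m → D) (g : Fin m → D'), z = ∑ k, f k ⊗ₜ[ℂ] g k := by
  obtain ⟨s, hs⟩ := TensorProduct.exists_finset z
  refine ⟨s.card, fun k => (s.equivFin.symm k).1.1, fun k => (s.equivFin.symm k).1.2, ?_⟩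
  rw [hs, ← Finset.sum_coe_sort]
  exact (s.equivFin.symm.sum_comp fun p => p.1.1 ⊗ₜ[ℂ] p.1.2).symm

open TensorProduct in
theorem injN_interpN_le (hθ : 0 < θ) (hθ1 : θ < 1) (hD : Approximable N₀ N₁ M)
    (hD' : Approximable N₀' N₁' M) (z : D ⊗[ℂ] D') :
    injN (interpN θ N₀ N₁) (interpN θ N₀' N₁') z ≤ interpN θ (injN N₀ N₀') (injN N₁ N₁') z := by
  refine injN_le (interpN_nonneg (apply_nonneg N₀)) (interpN_nonneg (apply_nonneg N₀'))
    fun φ ψ hφ hψ => le_of_forall_pos_le_add fun ε hε => ?_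
  obtain ⟨m, h, v, hh, rfl, h0, h1⟩ := exists_of_interpN_lt (lt_add_of_pos_right
    (interpN θ (injN N₀ N₀') (injN N₁ N₁') z) hε)
  set c := interpN θ (injN N₀ N₀') (injN N₁ N₁') (∑ i, h i θ • v i) + ε
  choose n f g hv using fun l => exists_eq_sum_tmul (v l)
  obtain ⟨ι, _, J, a, hJ₀, hJ₁, ha⟩ := hD.exists_rep fun p : (l : Fin m) × Fin (n l) => f p.1 p.2
  obtain ⟨κ, _, J', b, hJ'₀, hJ'₁, hb⟩ :=
    hD'.exists_rep fun p : (l : Fin m) × Fin (n l) => g p.1 p.2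
  obtain ⟨r, hr, hr₀, hr₁⟩ := exists_ratios_of_functional hθ hθ1 hJ₀ hJ₁ hφ
  obtain ⟨t, ht, ht₀, ht₁⟩ := exists_ratios_of_functional hθ hθ1 hJ'₀ hJ'₁ hψ
  have hsum : ∀ (s : ℂ) (Φ : D →ₗ[ℂ] ℂ) (Ψ : D' →ₗ[ℂ] ℂ),
      (∀ p : (l : Fin m) × Fin (n l), Φ (f p.1 p.2) = Φ (J (a p))) →
      (∀ p : (l : Fin m) × Fin (n l), Ψ (g p.1 p.2) = Ψ (J' (b p))) →
      tensFun Φ Ψ (∑ l, h l s • v l) =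
        ∑ p : (l : Fin m) × Fin (n l), h p.1 s * (Φ (J (a p)) * Ψ (J' (b p))) := by
    intro s Φ Ψ hΦ hΨ
    rw [Fintype.sum_sigma, map_sum]
    refine Finset.sum_congr rfl fun l _ => ?_
    rw [map_smul, hv l, map_sum, smul_eq_mul, Finset.mul_sum]
    refine Finset.sum_congr rfl fun k _ => ?_
    rw [tensFun_tmul, hΦ ⟨l, k⟩, hΨ ⟨l, k⟩]
  have hG : StripFun fun s => ∑ p : (l : Fin m) × Fin (n l), h p.1 s *
      ((∑ i, φ (atomVec J i) * (r i : ℂ) ^ (s - θ) * a p i) *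
        ∑ j, ψ (atomVec J' j) * (t j : ℂ) ^ (s - θ) * b p j) :=
    StripFun.sum _ fun p => (hh p.1).mul ((StripFun.sum _ fun i =>
      ((StripFun.const _).mul (StripFun.cpow (hr i) θ)).mul (StripFun.const _)).mul
        (StripFun.sum _ fun j =>
          ((StripFun.const _).mul (StripFun.cpow (ht j) θ)).mul (StripFun.const _)))
  have key := hG.norm_le hθ hθ1 (c := c) (fun y => ?_) fun y => ?_
  · rw [hsum θ φ ψ (fun p => eq_of_dominated hφ (interpN_eq_zero (ha p).1 (ha p).2))
      fun p => eq_of_dominated hψ (interpN_eq_zero (hb p).1 (hb p).2)]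
    simpa [apply_map_eq_sum] using key
  · obtain ⟨Φ, hΦ, hΦJ⟩ := exists_dominated_of_sum_le N₀ J
      (fun i => φ (atomVec J i) * (r i : ℂ) ^ (Complex.I * y - θ)) (fun x => by
        simpa only [norm_mul, norm_cpow_left (hr _)] using hr₀ x)
    obtain ⟨Ψ, hΨ, hΨJ⟩ := exists_dominated_of_sum_le N₀' J'
      (fun j => ψ (atomVec J' j) * (t j : ℂ) ^ (Complex.I * y - θ)) (fun x => by
        simpa only [norm_mul, norm_cpow_left (ht _)] using ht₀ x)
    simp_rw [← hΦJ, ← hΨJ]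
    rw [← hsum _ Φ Ψ (fun p => eq_of_dominated hΦ (ha p).1)
      fun p => eq_of_dominated hΨ (hb p).1]
    exact (le_injN _ hΦ hΨ).trans (h0 y)
  · obtain ⟨Φ, hΦ, hΦJ⟩ := exists_dominated_of_sum_le N₁ J
      (fun i => φ (atomVec J i) * (r i : ℂ) ^ (1 + Complex.I * y - θ)) (fun x => by
        simpa only [norm_mul, norm_cpow_right (hr _)] using hr₁ x)
    obtain ⟨Ψ, hΨ, hΨJ⟩ := exists_dominated_of_sum_le N₁' J'
      (fun j => ψ (atomVec J' j) * (t j : ℂ) ^ (1 + Complex.I * y - θ)) (fun x => by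
        simpa only [norm_mul, norm_cpow_right (ht _)] using ht₁ x)
    simp_rw [← hΦJ, ← hΨJ]
    rw [← hsum _ Φ Ψ (fun p => eq_of_dominated hΦ (ha p).2)
      fun p => eq_of_dominated hΨ (hb p).2]
    exact (le_injN _ hΦ hΨ).trans (h1 y)

end EasyInequality

section Nets

variable {D : Type*} [AddCommGroup D] [Module ℂ D] {N N₀ N₁ : Seminorm ℂ D} {θ : ℝ}

theorem seminorm_congr {x y : D} (h : N (x - y) = 0) : N x = N y := by
  have h1 := abs_sub_map_le_sub N x y
  rw [h] at h1
  exact sub_eq_zero.1 (abs_nonpos_iff.1 h1)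

theorem seminorm_sum_sub_eq_zero {ι K : Type*} [Fintype K] {J : (ι → ℂ) →ₗ[ℂ] D} {f : K → D}
    {a : K → ι → ℂ} (h : ∀ k, N (f k - J (a k)) = 0) (c : K → ℂ) :
    N (∑ k, c k • f k - J (∑ k, c k • a k)) = 0 := by
  refine le_antisymm ?_ (apply_nonneg _ _)
  have e : ∑ k, c k • f k - J (∑ k, c k • a k) = ∑ k, c k • (f k - J (a k)) := by
    simp [smul_sub]
  rw [e]
  refine (Finset.le_sum_of_subadditive N (map_zero N).le (map_add_le_add N) _ _).trans
    (le_of_eq (Finset.sum_eq_zero fun k _ => ?_))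
  rw [map_smul_eq_mul, h, mul_zero]

theorem seminorm_sum_le {m : ℕ} (f : Fin m → D) {C : ℝ} (hC : ∑ k, N (f k) ≤ C)
    (x : Fin m → ℂ) : N (∑ k, x k • f k) ≤ C * ‖x‖ := by
  refine (Finset.le_sum_of_subadditive N (map_zero N).le (map_add_le_add N) _ _).trans ?_
  refine le_trans ?_ (mul_le_mul_of_nonneg_right hC (norm_nonneg x))
  rw [Finset.sum_mul]
  refine Finset.sum_le_sum fun k _ => ?_
  rw [map_smul_eq_mul, mul_comm]
  exact mul_le_mul_of_nonneg_left (norm_le_pi_norm x k) (apply_nonneg _ _)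

theorem exists_finite_witnesses {m : ℕ} (f : Fin m → D) {δ : ℝ} (hδ : 0 < δ) :
    ∃ (K : Type) (_ : Fintype K) (w : K → D), ∀ (ι : Type) (J : (ι → ℂ) →ₗ[ℂ] D)
      (a : Fin m → ι → ℂ) (b : K → ι → ℂ),
      (∀ k, N₀ (f k - J (a k)) = 0 ∧ N₁ (f k - J (a k)) = 0) →
      (∀ k, N₀ (w k - J (b k)) = 0 ∧ N₁ (w k - J (b k)) = 0) →
      ∀ Λ : (ι → ℂ) →ₗ[ℂ] ℂ, (∀ x, ‖Λ x‖ ≤ interpN θ (N₀.comp J) (N₁.comp J) x) →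
        ∀ x : Fin m → ℂ, ‖Λ (∑ k, x k • a k)‖ ≤ interpN θ N₀ N₁ (∑ k, x k • f k) + δ * ‖x‖ := by
  obtain ⟨C, hC, hC₀, hC₁⟩ : ∃ C : ℝ, 0 < C ∧ ∑ k, N₀ (f k) ≤ C ∧ ∑ k, N₁ (f k) ≤ C := by
    have h0 : 0 ≤ ∑ k, N₀ (f k) := Finset.sum_nonneg fun k _ => apply_nonneg _ _
    have h1 : 0 ≤ ∑ k, N₁ (f k) := Finset.sum_nonneg fun k _ => apply_nonneg _ _
    exact ⟨∑ k, N₀ (f k) + ∑ k, N₁ (f k) + 1, by linarith, by linarith, by linarith⟩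
  obtain ⟨t, -, ht, hcov⟩ := (isCompact_closedBall (0 : Fin m → ℂ) 1).finite_cover_balls
    (show 0 < δ / (4 * C) by positivity)
  have := ht.fintype
  choose n h v hh hθv h0 h1 using fun s : Fin m → ℂ => exists_of_interpN_lt
    (lt_add_of_pos_right (interpN θ N₀ N₁ (∑ k, s k • f k)) (half_pos hδ))
  refine ⟨(s : t) × Fin (n s), inferInstance, fun p => v p.1 p.2, fun ι J a b ha hb Λ hΛ => ?_⟩
  have hcrude : ∀ x : Fin m → ℂ, ‖Λ (∑ k, x k • a k)‖ ≤ C * ‖x‖ := fun x => by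
    refine (hΛ _).trans ((interpN_le_max (apply_nonneg _) _).trans (max_le ?_ ?_))
    · rw [Seminorm.comp_apply,
        ← seminorm_congr (seminorm_sum_sub_eq_zero (fun k => (ha k).1) x)]
      exact seminorm_sum_le f hC₀ x
    · rw [Seminorm.comp_apply,
        ← seminorm_congr (seminorm_sum_sub_eq_zero (fun k => (ha k).2) x)]
      exact seminorm_sum_le f hC₁ x
  have hnet : ∀ s ∈ t, ‖Λ (∑ k, s k • a k)‖ ≤ interpN θ N₀ N₁ (∑ k, s k • f k) + δ / 2 := by
    intro s hs
    have hb' : ∀ l, N₀ (v s l - J (b ⟨⟨s, hs⟩, l⟩)) = 0 ∧ N₁ (v s l - J (b ⟨⟨s, hs⟩, l⟩)) = 0 :=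
      fun l => hb ⟨⟨s, hs⟩, l⟩
    have hdiff : ∀ N : Seminorm ℂ D, (∀ k, N (f k - J (a k)) = 0) →
        (∀ l, N (v s l - J (b ⟨⟨s, hs⟩, l⟩)) = 0) →
        N (J (∑ k, s k • a k - ∑ l, h s l θ • b ⟨⟨s, hs⟩, l⟩)) = 0 := by
      intro N hN hN'
      have e1 := seminorm_sum_sub_eq_zero hN s
      have e2 := seminorm_sum_sub_eq_zero hN' fun l => h s l θ
      rw [hθv s] at e2
      rw [map_sub, ← sub_sub_sub_cancel_left _ _ (∑ k, s k • f k)]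
      refine le_antisymm ((map_sub_le_add N _ _).trans ?_) (apply_nonneg _ _)
      rw [e1, e2, add_zero]
    rw [eq_of_dominated hΛ (interpN_eq_zero (hdiff N₀ (fun k => (ha k).1) fun l => (hb' l).1)
      (hdiff N₁ (fun k => (ha k).2) fun l => (hb' l).2))]
    refine (hΛ _).trans (interpN_le (apply_nonneg _) (h s) _ (hh s) rfl (fun y => ?_) fun y => ?_)
    · rw [Seminorm.comp_apply,
        ← seminorm_congr (seminorm_sum_sub_eq_zero (fun l => (hb' l).1) _)]
      exact h0 s y
    · rw [Seminorm.comp_apply,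
        ← seminorm_congr (seminorm_sum_sub_eq_zero (fun l => (hb' l).2) _)]
      exact h1 s y
  have hball : ∀ x : Fin m → ℂ, ‖x‖ ≤ 1 →
      ‖Λ (∑ k, x k • a k)‖ ≤ interpN θ N₀ N₁ (∑ k, x k • f k) + δ := by
    intro x hx
    obtain ⟨s, hs, hxs⟩ := Set.mem_iUnion₂.1 (hcov (mem_closedBall_zero_iff.2 hx))
    rw [Metric.mem_ball, dist_eq_norm, lt_div_iff₀ (by positivity)] at hxs
    have e1 : ∑ k, x k • a k = ∑ k, s k • a k + ∑ k, (x - s) k • a k := by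
      simp [sub_smul]
    have e2 : ∑ k, s k • f k = ∑ k, x k • f k + ∑ k, (s - x) k • f k := by
      simp [sub_smul]
    have e3 : interpN θ N₀ N₁ (∑ k, s k • f k) ≤
        interpN θ N₀ N₁ (∑ k, x k • f k) + C * ‖x - s‖ := by
      rw [e2, norm_sub_rev]
      refine (map_add_le_add (interpSeminorm θ N₀ N₁) _ _).trans (add_le_add le_rfl ?_)
      exact (interpN_le_max (apply_nonneg _) _).trans
        (max_le (seminorm_sum_le f hC₀ _) (seminorm_sum_le f hC₁ _))
    have e4 := hcrude (x - s)
    have e5 := hnet s hs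
    rw [e1, map_add]
    refine (norm_add_le _ _).trans ?_
    linarith
  intro x
  rcases eq_or_ne x 0 with rfl | hx
  · simpa using interpN_nonneg (apply_nonneg N₀) (0 : D)
  have hx' : 0 < ‖x‖ := norm_pos_iff.2 hx
  set u : Fin m → ℂ := ((‖x‖ : ℂ)⁻¹) • x with hu
  have hxu : x = (‖x‖ : ℂ) • u := by
    rw [hu, smul_smul, mul_inv_cancel₀ (by exact_mod_cast hx'.ne'), one_smul]
  have h2 := hball u (by
    rw [hu, norm_smul, norm_inv, Complex.norm_real, norm_norm, inv_mul_cancel₀ hx'.ne'])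
  have hxk : ∀ k, x k = (‖x‖ : ℂ) * u k := fun k => congrFun hxu k
  have e1 : ∑ k, x k • a k = (‖x‖ : ℂ) • ∑ k, u k • a k := by
    rw [Finset.smul_sum]
    refine Finset.sum_congr rfl fun k _ => ?_
    rw [smul_smul, ← hxk]
  have e2 : ∑ k, x k • f k = (‖x‖ : ℂ) • ∑ k, u k • f k := by
    rw [Finset.smul_sum]
    refine Finset.sum_congr rfl fun k _ => ?_
    rw [smul_smul, ← hxk]
  have e3 := map_smul_eq_mul (interpSeminorm θ N₀ N₁) (‖x‖ : ℂ) (∑ k, u k • f k)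
  rw [interpSeminorm_apply, interpSeminorm_apply, Complex.norm_real, norm_norm] at e3
  rw [e1, e2, e3, map_smul, norm_smul, Complex.norm_real, norm_norm]
  nlinarith

theorem exists_finite_witnesses_calderonBall (hθ : 0 < θ) (hθ1 : θ < 1) {m : ℕ} (f : Fin m → D)
    {δ : ℝ} (hδ : 0 < δ) :
    ∃ (K : Type) (_ : Fintype K) (w : K → D), ∀ (ι : Type) [Fintype ι] (J : (ι → ℂ) →ₗ[ℂ] D)
      (a : Fin m → ι → ℂ) (b : K → ι → ℂ),
      (∀ k, N₀ (f k - J (a k)) = 0 ∧ N₁ (f k - J (a k)) = 0) →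
      (∀ k, N₀ (w k - J (b k)) = 0 ∧ N₁ (w k - J (b k)) = 0) →
      ∀ φ ∈ calderonBall θ (dualSquares N₀ J) (dualSquares N₁ J),
        ∃ Φ : D →ₗ[ℂ] ℂ, (∀ x, ‖Φ x‖ ≤ interpN θ N₀ N₁ x) ∧
          ∀ k, ‖∑ i, φ i * a k i - Φ (f k)‖ ≤ δ := by
  obtain ⟨K, hK, w, hw⟩ := exists_finite_witnesses (N₀ := N₀) (N₁ := N₁) (θ := θ) f hδ
  refine ⟨K, hK, w, fun ι _ J a b ha hb φ hφ => ?_⟩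
  let Λ : (ι → ℂ) →ₗ[ℂ] ℂ := ∑ i, φ i • LinearMap.proj i
  have hΛ : ∀ x, Λ x = ∑ i, φ i * x i := fun x => by simp [Λ]
  let A : (Fin m → ℂ) →ₗ[ℂ] (ι → ℂ) := Fintype.linearCombination ℂ a
  let T : (Fin m → ℂ) →ₗ[ℂ] D := Fintype.linearCombination ℂ f
  obtain ⟨Φ, hΦ, hΦT⟩ := exists_dominated_extension (interpSeminorm θ N₀ N₁)
    (δ.toNNReal • normSeminorm ℂ (Fin m → ℂ)) T (Λ ∘ₗ A) (fun x => by
      have := hw ι J a b ha hb Λ (fun x => by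
        rw [hΛ]; exact norm_sum_le_interpN hθ hθ1 hφ x) x
      simpa [A, T, Fintype.linearCombination_apply, NNReal.smul_def, hδ.le, interpSeminorm_apply]
        using this)
  classical
  refine ⟨Φ, hΦ, fun k => ?_⟩
  have h1 := hΦT (Pi.single k 1)
  simp only [LinearMap.comp_apply, A, T, Fintype.linearCombination_apply_single, one_smul,
    hΛ] at h1
  refine h1.trans (le_of_eq ?_)
  simp [NNReal.smul_def, hδ.le, Pi.norm_single]

end Nets

section HardInequality

variable {D D' : Type*} [AddCommGroup D] [Module ℂ D] [AddCommGroup D'] [Module ℂ D']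
  {N₀ N₁ : Seminorm ℂ D} {N₀' N₁' : Seminorm ℂ D'} {M θ : ℝ}

theorem LatticeRep.sq_mem_dualSquares {ι : Type*} [Fintype ι] {N : Seminorm ℂ D}
    {J : (ι → ℂ) →ₗ[ℂ] D} (hJ : LatticeRep N M J) {φ : D →ₗ[ℂ] ℂ} (hφ : ∀ x, ‖φ x‖ ≤ N x) :
    (fun i => ‖φ (atomVec J i)‖ ^ 2) ∈ dualSquares N J := by
  refine ⟨fun i => sq_nonneg _, fun x => ?_⟩
  have hphase : ∀ w : ℂ, ∃ u : ℂ, ‖u‖ = 1 ∧ w * u = (‖w‖ : ℂ) := by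
    intro w
    rcases eq_or_ne w 0 with rfl | hw
    · exact ⟨1, by simp⟩
    · have hw' : (‖w‖ : ℂ) ≠ 0 := by simpa using hw
      refine ⟨(starRingEnd ℂ) w / ‖w‖, by simp [hw], ?_⟩
      rw [← mul_div_assoc, Complex.mul_conj, Complex.normSq_eq_norm_sq, div_eq_iff hw']
      push_cast
      ring
  choose u hu1 hu using fun i => hphase (φ (atomVec J i))
  have h1 : φ (J fun i => u i * (‖x i‖ : ℂ)) =
      ((∑ i, √(‖φ (atomVec J i)‖ ^ 2) * ‖x i‖ : ℝ) : ℂ) := by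
    rw [apply_map_eq_sum, Complex.ofReal_sum]
    refine Finset.sum_congr rfl fun i _ => ?_
    rw [← mul_assoc, hu, Real.sqrt_sq (norm_nonneg _), Complex.ofReal_mul]
  have h2 := (hφ _).trans (hJ.mono (fun i => u i * (‖x i‖ : ℂ)) x fun i => by simp [hu1])
  rw [h1, Complex.norm_real] at h2
  exact (le_abs_self _).trans h2

theorem norm_sum_mul_sub_sum_mul_le {m : ℕ} (u v u' v' : Fin m → ℂ) (B B' : Fin m → ℝ)
    (hB : ∀ k, ‖u' k‖ ≤ B k) (hB' : ∀ k, ‖v' k‖ ≤ B' k) {δ : ℝ} (hδ : 0 ≤ δ) (hδ1 : δ ≤ 1)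
    (hu : ∀ k, ‖u k - u' k‖ ≤ δ) (hv : ∀ k, ‖v k - v' k‖ ≤ δ) :
    ‖∑ k, u k * v k - ∑ k, u' k * v' k‖ ≤ δ * ∑ k, (B k + B' k + 1) := by
  rw [← Finset.sum_sub_distrib, Finset.mul_sum]
  refine (norm_sum_le _ _).trans (Finset.sum_le_sum fun k _ => ?_)
  have e : u k * v k - u' k * v' k =
      (u k - u' k) * (v k - v' k) + (u k - u' k) * v' k + u' k * (v k - v' k) := by ring
  rw [e]
  refine (norm_add₃_le).trans ?_
  rw [norm_mul, norm_mul, norm_mul]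
  have h1 : ‖u k - u' k‖ * ‖v k - v' k‖ ≤ δ * 1 :=
    mul_le_mul (hu k) ((hv k).trans hδ1) (norm_nonneg _) hδ
  have h2 : ‖u k - u' k‖ * ‖v' k‖ ≤ δ * B' k :=
    mul_le_mul (hu k) (hB' k) (norm_nonneg _) hδ
  have h3 : ‖u' k‖ * ‖v k - v' k‖ ≤ B k * δ :=
    mul_le_mul (hB k) (hv k) (norm_nonneg _) ((norm_nonneg _).trans (hB k))
  linarith

theorem matForm_sum_mul {ι κ : Type*} [Fintype ι] [Fintype κ] {m : ℕ} (a : Fin m → ι → ℂ)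
    (b : Fin m → κ → ℂ) (φ : ι → ℂ) (ψ : κ → ℂ) :
    matForm (fun i j => ∑ k, a k i * b k j) φ ψ =
      ∑ k, (∑ i, φ i * a k i) * ∑ j, ψ j * b k j := by
  simp_rw [matForm, Finset.sum_mul_sum, Finset.sum_mul]
  calc _ = ∑ i, ∑ k, ∑ j, a k i * b k j * (φ i * ψ j) :=
        Finset.sum_congr rfl fun i _ => Finset.sum_comm
    _ = ∑ k, ∑ i, ∑ j, a k i * b k j * (φ i * ψ j) := Finset.sum_comm
    _ = _ := Finset.sum_congr rfl fun k _ => Finset.sum_congr rfl fun i _ =>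
        Finset.sum_congr rfl fun j _ => by ring

open TensorProduct in
theorem interpN_injN_le (hθ : 0 < θ) (hθ1 : θ < 1) (hM : 0 < M) (hD : Approximable N₀ N₁ M)
    (hD' : Approximable N₀' N₁' M) (z : D ⊗[ℂ] D') :
    interpN θ (injN N₀ N₀') (injN N₁ N₁') z ≤
      432 * M ^ 2 * injN (interpN θ N₀ N₁) (interpN θ N₀' N₁') z := by
  set I := injN (interpN θ N₀ N₁) (interpN θ N₀' N₁') z with hI
  suffices H : ∀ ε > 0, interpN θ (injN N₀ N₀') (injN N₁ N₁') z ≤ 432 * M ^ 2 * (I + ε) by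
    refine le_of_forall_pos_le_add fun ε hε => ?_
    have hM' : 432 * M ^ 2 ≠ 0 := by positivity
    refine (H (ε / (432 * M ^ 2)) (by positivity)).trans (le_of_eq ?_)
    rw [mul_add, mul_div_cancel₀ _ hM']
  intro ε hε
  have hI0 : 0 ≤ I := injN_nonneg z
  obtain ⟨m, f, g, hz⟩ := exists_eq_sum_tmul z
  set S := ∑ k, (interpN θ N₀ N₁ (f k) + interpN θ N₀' N₁' (g k) + 1) with hS
  have hS0 : 0 ≤ S := Finset.sum_nonneg fun k _ => add_nonneg (add_nonneg
    (interpN_nonneg (apply_nonneg N₀) _) (interpN_nonneg (apply_nonneg N₀') _)) zero_le_one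
  obtain ⟨δ, hδ, hδ1, hδS⟩ : ∃ δ : ℝ, 0 < δ ∧ δ ≤ 1 ∧ δ * S ≤ ε := by
    refine ⟨min 1 (ε / (S + 1)), lt_min one_pos (by positivity), min_le_left _ _, ?_⟩
    calc _ ≤ ε / (S + 1) * (S + 1) := mul_le_mul (min_le_right _ _) (by linarith) hS0
          (by positivity)
      _ = ε := div_mul_cancel₀ _ (by positivity)
  obtain ⟨K, _, w, hw⟩ := exists_finite_witnesses_calderonBall (N₀ := N₀) (N₁ := N₁) hθ hθ1 f hδ
  obtain ⟨K', _, w', hw'⟩ :=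
    exists_finite_witnesses_calderonBall (N₀ := N₀') (N₁ := N₁') hθ hθ1 g hδ
  obtain ⟨ι, _, J, a, hJ₀, hJ₁, ha⟩ := hD.exists_rep (Sum.elim f w)
  obtain ⟨κ, _, J', b, hJ'₀, hJ'₁, hb⟩ := hD'.exists_rep (Sum.elim g w')
  have haf : ∀ k, N₀ (f k - J (a (Sum.inl k))) = 0 ∧ N₁ (f k - J (a (Sum.inl k))) = 0 :=
    fun k => ha (Sum.inl k)
  have hbg : ∀ k, N₀' (g k - J' (b (Sum.inl k))) = 0 ∧ N₁' (g k - J' (b (Sum.inl k))) = 0 :=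
    fun k => hb (Sum.inl k)
  set Z : ι → κ → ℂ := fun i j => ∑ k, a (Sum.inl k) i * b (Sum.inl k) j with hZ
  have hball : ∀ φ ∈ calderonBall θ (dualSquares N₀ J) (dualSquares N₁ J),
      ∀ ψ ∈ calderonBall θ (dualSquares N₀' J') (dualSquares N₁' J'),
      ‖matForm Z φ ψ‖ ≤ I + ε := by
    intro φ hφ ψ hψ
    obtain ⟨Φ, hΦ, hΦf⟩ := hw ι J _ _ haf (fun k => ha (Sum.inr k)) φ hφ
    obtain ⟨Ψ, hΨ, hΨg⟩ := hw' κ J' _ _ hbg (fun k => hb (Sum.inr k)) ψ hψ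
    have h1 := norm_sum_mul_sub_sum_mul_le _ _ _ _ _ _ (fun k => hΦ (f k)) (fun k => hΨ (g k))
      hδ.le hδ1 hΦf hΨg
    have h2 : ‖∑ k, Φ (f k) * Ψ (g k)‖ ≤ I := by
      have := le_injN z hΦ hΨ
      rw [← hI, hz, map_sum] at this
      simpa only [tensFun_tmul] using this
    rw [hZ, matForm_sum_mul]
    have h3 := norm_le_norm_add_norm_sub' (∑ k, (∑ i, φ i * a (Sum.inl k) i) *
      ∑ j, ψ j * b (Sum.inl k) j) (∑ k, Φ (f k) * Ψ (g k))
    linarith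
  obtain ⟨r, t, hr, ht, hrt⟩ := exists_ratios_of_matForm hθ hθ1 (by positivity : 0 < M ^ 2)
    (by linarith : 0 < I + ε) (hJ₀.goodSet hM) (hJ₁.goodSet hM) (hJ'₀.goodSet hM)
    (hJ'₁.goodSet hM) Z hball
  let h : Option (ι × κ) → ℂ → ℂ := fun o s =>
    o.elim 1 fun p => Z p.1 p.2 * ((r p.1 : ℂ) ^ (s - θ) * (t p.2 : ℂ) ^ (s - θ))
  let v : Option (ι × κ) → D ⊗[ℂ] D' := fun o =>
    o.elim (z - ∑ p : ι × κ, Z p.1 p.2 • (atomVec J p.1 ⊗ₜ[ℂ] atomVec J' p.2))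
      fun p => atomVec J p.1 ⊗ₜ[ℂ] atomVec J' p.2
  have hh : ∀ o, StripFun (h o) := by
    rintro (_ | p)
    · exact StripFun.const 1
    · exact (StripFun.const _).mul ((StripFun.cpow (hr _) θ).mul (StripFun.cpow (ht _) θ))
  have hform : ∀ (s : ℂ) (Φ : D →ₗ[ℂ] ℂ) (Ψ : D' →ₗ[ℂ] ℂ),
      (∀ k, Φ (f k) = Φ (J (a (Sum.inl k)))) → (∀ k, Ψ (g k) = Ψ (J' (b (Sum.inl k)))) →
      tensFun Φ Ψ (∑ o, h o s • v o) =
        matForm Z (fun i => Φ (atomVec J i) * (r i : ℂ) ^ (s - θ))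
          fun j => Ψ (atomVec J' j) * (t j : ℂ) ^ (s - θ) := by
    intro s Φ Ψ hΦ hΨ
    have e1 : tensFun Φ Ψ z = matForm Z (fun i => Φ (atomVec J i)) fun j => Ψ (atomVec J' j) := by
      rw [hZ, matForm_sum_mul, hz, map_sum]
      refine Finset.sum_congr rfl fun k _ => ?_
      rw [tensFun_tmul, hΦ, hΨ, apply_map_eq_sum, apply_map_eq_sum]
    simp only [Fintype.sum_option, h, v, Option.elim_none, Option.elim_some, one_smul,
      map_add, map_sub, map_sum, map_smul, tensFun_tmul, smul_eq_mul, e1]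
    simp only [matForm, Fintype.sum_prod_type, sub_self, zero_add]
    refine Finset.sum_congr rfl fun i _ => Finset.sum_congr rfl fun j _ => ?_
    ring
  have hcancel : ∀ {x : ℝ}, 0 < x → ∀ s y : ℝ, y * x ^ (-s) * x ^ s = y := fun hx s y => by
    rw [mul_assoc, ← Real.rpow_add hx, neg_add_cancel, Real.rpow_zero, mul_one]
  have hbd : 432 * (M ^ 2 * (I + ε)) = 432 * M ^ 2 * (I + ε) := by ring
  rw [hbd] at hrt
  refine interpN_le injN_nonneg h v hh ?_ (fun y => injN_le (apply_nonneg _) (apply_nonneg _)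
    fun Φ Ψ hΦ hΨ => ?_) fun y => injN_le (apply_nonneg _) (apply_nonneg _) fun Φ Ψ hΦ hΨ => ?_
  · simp only [Fintype.sum_option, h, v, Option.elim_none, Option.elim_some, one_smul, sub_self,
      Complex.cpow_zero, mul_one, sub_add_cancel]
  · rw [hform _ Φ Ψ (fun k => eq_of_dominated hΦ (haf k).1)
      fun k => eq_of_dominated hΨ (hbg k).1]
    refine hrt _ _ (Or.inl ?_) (Or.inl ?_)
    · simpa only [norm_mul, norm_cpow_left (hr _), hcancel (hr _)] using
        hJ₀.sq_mem_dualSquares hΦ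
    · simpa only [norm_mul, norm_cpow_left (ht _), hcancel (ht _)] using
        hJ'₀.sq_mem_dualSquares hΨ
  · have hneg : (1 - θ) = -(θ - 1) := by ring
    rw [hform _ Φ Ψ (fun k => eq_of_dominated hΦ (haf k).2)
      fun k => eq_of_dominated hΨ (hbg k).2]
    refine hrt _ _ (Or.inr ?_) (Or.inr ?_)
    · simpa only [norm_mul, norm_cpow_right (hr _), hneg, hcancel (hr _)] using
        hJ₁.sq_mem_dualSquares hΦ
    · simpa only [norm_mul, norm_cpow_right (ht _), hneg, hcancel (ht _)] using
        hJ'₁.sq_mem_dualSquares hΨ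

end HardInequality

section SimpleFunctions

variable {Ω : Type*} [MeasurableSpace Ω] {μ : Measure Ω}

theorem mem_simpleSub_induction {p : (Ω → ℂ) → Prop} (hzero : p 0)
    (hadd : ∀ f g, p f → p g → p (f + g)) (hsmul : ∀ (c : ℂ) f, p f → p (c • f))
    (hind : ∀ s, MeasurableSet s → μ s < ⊤ → p (s.indicator fun _ => 1)) {f : Ω → ℂ}
    (hf : f ∈ SimpleSub μ ℂ) : p f := by
  refine Submodule.span_induction ?_ hzero (fun f g _ _ => hadd f g) (fun c f _ => hsmul c f) hf
  rintro _ ⟨s, v, hs, hμs, rfl⟩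
  have e : (s.indicator fun _ => v) = v • s.indicator fun _ => (1 : ℂ) := by
    ext ω
    by_cases h : ω ∈ s <;> simp [h]
  rw [e]
  exact hsmul _ _ (hind s hs hμs)

theorem BFS.mem_of_mem_simpleSub (X : BFS Ω μ ℂ) {f : Ω → ℂ} (hf : f ∈ SimpleSub μ ℂ) : X.mem f :=
  mem_simpleSub_induction X.mem_zero X.mem_add X.mem_smul X.mem_indicator hf

/-- The norm of a Banach function space on the strictly simple functions. -/
def BFS.simpleSeminorm (X : BFS Ω μ ℂ) : Seminorm ℂ (SimpleSub μ ℂ) :=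
  Seminorm.of (fun f => X.nrm f)
    (fun f g => X.nrm_add f g (X.mem_of_mem_simpleSub f.2) (X.mem_of_mem_simpleSub g.2))
    fun c f => X.nrm_smul c f

theorem BFS.simpleSeminorm_mono (X : BFS Ω μ ℂ) {f g : SimpleSub μ ℂ}
    (h : ∀ᵐ ω ∂μ, ‖(f : Ω → ℂ) ω‖ ≤ ‖(g : Ω → ℂ) ω‖) : X.simpleSeminorm f ≤ X.simpleSeminorm g :=
  (X.ideal f g (X.mem_meas _ (X.mem_of_mem_simpleSub f.2)) (X.mem_of_mem_simpleSub g.2) h).2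

theorem BFS.simpleSeminorm_eq_zero (X : BFS Ω μ ℂ) {f : SimpleSub μ ℂ}
    (h : ∀ᵐ ω ∂μ, (f : Ω → ℂ) ω = 0) : X.simpleSeminorm f = 0 := by
  refine le_antisymm ?_ (apply_nonneg _ _)
  rw [← map_zero X.simpleSeminorm]
  exact X.simpleSeminorm_mono (h.mono fun ω hω => by simp [hω])

theorem BFS.RConcaveWith.mono {X : BFS Ω μ ℂ} {r C C' : ℝ} (h : X.RConcaveWith r C)
    (hC : C ≤ C') : X.RConcaveWith r C' := fun m f hf =>
  (h m f hf).trans (mul_le_mul_of_nonneg_right hC (X.nrm_nonneg _))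

theorem simpleSub_properties {f : Ω → ℂ} (hf : f ∈ SimpleSub μ ℂ) :
    Measurable f ∧ (Set.range f).Finite ∧ μ {ω | f ω ≠ 0} < ⊤ := by
  refine mem_simpleSub_induction (p := fun f => Measurable f ∧ (Set.range f).Finite ∧
    μ {ω | f ω ≠ 0} < ⊤) ?_ ?_ ?_ ?_ hf
  · refine ⟨measurable_const, (Set.finite_singleton (0 : ℂ)).subset ?_, by simp⟩
    rintro _ ⟨ω, rfl⟩
    rfl
  · rintro f g ⟨hf1, hf2, hf3⟩ ⟨hg1, hg2, hg3⟩
    refine ⟨hf1.add hg1, (hf2.add hg2).subset ?_,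
      (measure_mono ?_).trans_lt (measure_union_lt_top hf3 hg3)⟩
    · rintro _ ⟨ω, rfl⟩
      exact Set.add_mem_add ⟨ω, rfl⟩ ⟨ω, rfl⟩
    · intro ω hω
      by_contra hc
      simp only [Set.mem_union, Set.mem_ofPred_eq, not_or, not_not] at hc
      exact hω (by simp [hc.1, hc.2])
  · rintro c f ⟨hf1, hf2, hf3⟩
    refine ⟨hf1.const_smul c, (hf2.image fun x => c * x).subset ?_,
      (measure_mono ?_).trans_lt hf3⟩
    · rintro _ ⟨ω, rfl⟩
      exact ⟨f ω, ⟨ω, rfl⟩, rfl⟩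
    · intro ω hω h0
      exact hω (by simp [h0])
  · intro s hs hμs
    refine ⟨measurable_const.indicator hs,
      ((Set.finite_singleton (1 : ℂ)).insert 0).subset ?_, (measure_mono ?_).trans_lt hμs⟩
    · rintro _ ⟨ω, rfl⟩
      by_cases h : ω ∈ s <;> simp [h]
    · intro ω hω
      by_contra h
      exact hω (by simp [h])

variable {ι : Type*} [Fintype ι]

/-- The strictly simple function taking the value `x i` on `s i`. -/
def stepMap (s : ι → Set Ω) (hs : ∀ i, MeasurableSet (s i)) (hμs : ∀ i, μ (s i) < ⊤) :
    (ι → ℂ) →ₗ[ℂ] SimpleSub μ ℂ :=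
  Fintype.linearCombination ℂ fun i =>
    ⟨(s i).indicator fun _ => 1, Submodule.subset_span ⟨s i, 1, hs i, hμs i, rfl⟩⟩

variable {s : ι → Set Ω} (hs : ∀ i, MeasurableSet (s i)) (hμs : ∀ i, μ (s i) < ⊤)

theorem stepMap_apply (x : ι → ℂ) (ω : Ω) :
    (stepMap s hs hμs x : Ω → ℂ) ω = ∑ i, x i * (s i).indicator (fun _ => 1) ω := by
  simp [stepMap, Fintype.linearCombination_apply]

theorem stepMap_apply_of_mem (hd : ∀ i j ω, ω ∈ s i → ω ∈ s j → i = j) (x : ι → ℂ) {i : ι}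
    {ω : Ω} (hω : ω ∈ s i) : (stepMap s hs hμs x : Ω → ℂ) ω = x i := by
  rw [stepMap_apply, Finset.sum_eq_single i]
  · simp [hω]
  · intro j _ hj
    have : ω ∉ s j := fun h => hj (hd j i ω h hω)
    simp [this]
  · simp

theorem stepMap_apply_of_notMem (x : ι → ℂ) {ω : Ω} (hω : ∀ i, ω ∉ s i) :
    (stepMap s hs hμs x : Ω → ℂ) ω = 0 := by
  rw [stepMap_apply]
  exact Finset.sum_eq_zero fun i _ => by simp [hω i]

theorem BFS.latticeRep_stepMap {X : BFS Ω μ ℂ} {M : ℝ} (hX : X.RConcaveWith 2 M)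
    (hd : ∀ i j ω, ω ∈ s i → ω ∈ s j → i = j) (hpos : ∀ i, μ (s i) ≠ 0) :
    LatticeRep X.simpleSeminorm M (stepMap s hs hμs) where
  mono x y h := X.simpleSeminorm_mono <| Filter.Eventually.of_forall fun ω => by
    by_cases hω : ∃ i, ω ∈ s i
    · obtain ⟨i, hi⟩ := hω
      rw [stepMap_apply_of_mem hs hμs hd x hi, stepMap_apply_of_mem hs hμs hd y hi]
      exact h i
    · push Not at hω
      rw [stepMap_apply_of_notMem hs hμs x hω, stepMap_apply_of_notMem hs hμs y hω]
  concave n x := by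
    have h1 := hX n (fun k => (stepMap s hs hμs (x k) : Ω → ℂ))
      fun k => X.mem_of_mem_simpleSub (Subtype.prop _)
    have e : (fun ω => (((∑ k, ‖(stepMap s hs hμs (x k) : Ω → ℂ) ω‖ ^ (2 : ℝ)) ^ (1 / (2 : ℝ)) : ℝ)
        : ℂ)) = (stepMap s hs hμs fun i => ((√(∑ k, ‖x k i‖ ^ 2) : ℝ) : ℂ) : Ω → ℂ) := by
      ext ω
      by_cases hω : ∃ i, ω ∈ s i
      · obtain ⟨i, hi⟩ := hω
        simp only [stepMap_apply_of_mem hs hμs hd _ hi, Real.rpow_two, ← Real.sqrt_eq_rpow]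
      · push Not at hω
        simp [stepMap_apply_of_notMem hs hμs _ hω]
    have h2 := h1.trans_eq (congrArg (fun f => M * X.nrm f) e)
    simp only [Real.rpow_two, ← Real.sqrt_eq_rpow] at h2
    rw [← mul_pow]
    exact (Real.sqrt_le_left ((Real.sqrt_nonneg _).trans h2)).1 h2
  pos i := by
    classical
    refine (apply_nonneg _ _).lt_of_ne' fun h => hpos i ?_
    have h0 := X.nrm_eq_zero _ (X.mem_of_mem_simpleSub (Subtype.prop _)) h
    have h1 : ∀ᵐ ω ∂μ, ω ∉ s i := h0.mono fun ω hω hi => by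
      rw [atomVec, stepMap_apply_of_mem hs hμs hd _ hi] at hω
      simp at hω
    rw [ae_iff] at h1
    simpa using h1

theorem BFS.approximable {X₀ X₁ : BFS Ω μ ℂ} {M : ℝ} (h₀ : X₀.RConcaveWith 2 M)
    (h₁ : X₁.RConcaveWith 2 M) : Approximable X₀.simpleSeminorm X₁.simpleSeminorm M := by
  intro m f
  have hf := fun k => simpleSub_properties (f k).2
  let F : Ω → Fin m → ℂ := fun ω k => (f k : Ω → ℂ) ω
  have hFm : Measurable F := measurable_pi_lambda _ fun k => (hf k).1
  have hFr : (Set.range F).Finite := by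
    refine (Set.Finite.pi' fun k => (hf k).2.1).subset ?_
    rintro _ ⟨ω, rfl⟩ k
    exact ⟨ω, rfl⟩
  let A : Set (Fin m → ℂ) := {c | c ∈ Set.range F ∧ c ≠ 0 ∧ μ (F ⁻¹' {c}) ≠ 0}
  have hA : A.Finite := hFr.subset fun c hc => hc.1
  have := hA.fintype
  let s : A → Set Ω := fun c => F ⁻¹' {c.1}
  have hs : ∀ c, MeasurableSet (s c) := fun c => hFm (measurableSet_singleton _)
  have hμs : ∀ c, μ (s c) < ⊤ := by
    rintro ⟨c, -, hc, -⟩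
    obtain ⟨k, hk⟩ := Function.ne_iff.1 hc
    refine (measure_mono fun ω hω => ?_).trans_lt (hf k).2.2
    rw [Set.mem_ofPred_eq, show (f k : Ω → ℂ) ω = c k from congrFun hω k]
    exact hk
  have hd : ∀ i j ω, ω ∈ s i → ω ∈ s j → i = j := fun i j ω hi hj =>
    Subtype.ext (hi.symm.trans hj)
  have hpos : ∀ c, μ (s c) ≠ 0 := fun c => c.2.2.2
  have hae : ∀ᵐ ω ∂μ, ∀ c ∈ Set.range F, μ (F ⁻¹' {c}) = 0 → F ω ≠ c := by
    refine (ae_ball_iff hFr.countable).2 fun c _ => ?_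
    by_cases hc : μ (F ⁻¹' {c}) = 0
    · rw [← compl_compl (F ⁻¹' {c}), ← mem_ae_iff] at hc
      filter_upwards [hc] with ω hω _ using hω
    · exact Filter.Eventually.of_forall fun ω h => absurd h hc
  have hnull : ∀ k, ∀ᵐ ω ∂μ, ((f k - stepMap s hs hμs fun c => c.1 k :) : Ω → ℂ) ω = 0 := by
    intro k
    filter_upwards [hae] with ω hω
    rw [Submodule.coe_sub, Pi.sub_apply, sub_eq_zero]
    by_cases hF : F ω ∈ A
    · rw [stepMap_apply_of_mem hs hμs hd _ (i := ⟨F ω, hF⟩) rfl]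
    · rw [stepMap_apply_of_notMem hs hμs _ fun c (hc : F ω = c.1) => hF (hc ▸ c.2)]
      by_contra h
      exact hF ⟨⟨ω, rfl⟩, fun h0 => h (congrFun h0 k), fun h0 => hω _ ⟨ω, rfl⟩ h0 rfl⟩
  exact ⟨A, inferInstance, stepMap s hs hμs, fun k c => c.1 k,
    BFS.latticeRep_stepMap hs hμs h₀ hd hpos, BFS.latticeRep_stepMap hs hμs h₁ hd hpos,
    fun k => ⟨X₀.simpleSeminorm_eq_zero (hnull k), X₁.simpleSeminorm_eq_zero (hnull k)⟩⟩

end SimpleFunctions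

/-- Kouba's formula for scalar-valued Banach function spaces:
`[X₀⊗̂_εY₀,X₁⊗̂_εY₁]_θ = [X₀,X₁]_θ⊗̂_ε[Y₀,Y₁]_θ` for 2-concave complex-valued
Banach function spaces, expressed as a two-sided norm equivalence on the dense
subspace of strictly simple functions. -/
theorem statement18 {Ω₁ Ω₂ : Type*} [MeasurableSpace Ω₁] [MeasurableSpace Ω₂]
    (μ : Measure Ω₁) (ν : Measure Ω₂) [SigmaFinite μ] [SigmaFinite ν]
    (hμc : μ.IsComplete) (hνc : ν.IsComplete)
    (X₀ X₁ : BFS Ω₁ μ ℂ) (Y₀ Y₁ : BFS Ω₂ ν ℂ)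
    (MX₀ MX₁ MY₀ MY₁ : ℝ)
    (hX₀ : X₀.RConcaveWith 2 MX₀) (hX₁ : X₁.RConcaveWith 2 MX₁)
    (hY₀ : Y₀.RConcaveWith 2 MY₀) (hY₁ : Y₁.RConcaveWith 2 MY₁)
    (θ : ℝ) (hθ : 0 < θ) (hθ1 : θ < 1) :
    ∃ C : ℝ, 0 < C ∧ ∀ z : TensorProduct ℂ (SimpleSub μ ℂ) (SimpleSub ν ℂ),
      injN (interpN θ (fun f : SimpleSub μ ℂ => X₀.nrm (f : Ω₁ → ℂ))
            (fun f : SimpleSub μ ℂ => X₁.nrm (f : Ω₁ → ℂ)))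
          (interpN θ (fun g : SimpleSub ν ℂ => Y₀.nrm (g : Ω₂ → ℂ))
            (fun g : SimpleSub ν ℂ => Y₁.nrm (g : Ω₂ → ℂ))) z ≤
        interpN θ
          (injN (fun f : SimpleSub μ ℂ => X₀.nrm (f : Ω₁ → ℂ))
            (fun g : SimpleSub ν ℂ => Y₀.nrm (g : Ω₂ → ℂ)))
          (injN (fun f : SimpleSub μ ℂ => X₁.nrm (f : Ω₁ → ℂ))
            (fun g : SimpleSub ν ℂ => Y₁.nrm (g : Ω₂ → ℂ))) z ∧
      interpN θ
          (injN (fun f : SimpleSub μ ℂ => X₀.nrm (f : Ω₁ → ℂ))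
            (fun g : SimpleSub ν ℂ => Y₀.nrm (g : Ω₂ → ℂ)))
          (injN (fun f : SimpleSub μ ℂ => X₁.nrm (f : Ω₁ → ℂ))
            (fun g : SimpleSub ν ℂ => Y₁.nrm (g : Ω₂ → ℂ))) z ≤
        C * injN (interpN θ (fun f : SimpleSub μ ℂ => X₀.nrm (f : Ω₁ → ℂ))
            (fun f : SimpleSub μ ℂ => X₁.nrm (f : Ω₁ → ℂ)))
          (interpN θ (fun g : SimpleSub ν ℂ => Y₀.nrm (g : Ω₂ → ℂ))
            (fun g : SimpleSub ν ℂ => Y₁.nrm (g : Ω₂ → ℂ))) z := by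
  set M := max 1 (max (max MX₀ MX₁) (max MY₀ MY₁)) with hMdef
  have hM : 0 < M := lt_max_of_lt_left one_pos
  have hX : Approximable X₀.simpleSeminorm X₁.simpleSeminorm M :=
    BFS.approximable (hX₀.mono (by simp [hMdef])) (hX₁.mono (by simp [hMdef]))
  have hY : Approximable Y₀.simpleSeminorm Y₁.simpleSeminorm M :=
    BFS.approximable (hY₀.mono (by simp [hMdef])) (hY₁.mono (by simp [hMdef]))
  exact ⟨432 * M ^ 2, by positivity, fun z =>
    ⟨injN_interpN_le hθ hθ1 hX hY z, interpN_injN_le hθ hθ1 hM hX hY z⟩⟩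

end Paper
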